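/- Let p be a prime and let G be a finite p-group. The following are equivalent: (i) G is not elementary abelian; (ii) there exists i such that H^i(G) contains an element of order p^2; (iii) for infinitely many i, H^i(G) contains an element of order p^2. -/

import Mathlib

/-- A group is elementary abelian for the prime `p` if it is abelian and every element has
order dividing `p`. -/
def IsElementaryAbelian (p : ℕ) (G : Type) [Group G] : Prop :=
  (∀ a b : G, a * b = b * a) ∧ ∀ g : G, g ^ p = 1



namespace PSq

/-- The bar resolution in degree `n`: finitely supported functions on `G^(n+1)`. -/
def P (G : Type) (n : ℕ) : Type := (Fin (n + 1) → G) →₀ ℤ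

noncomputable instance (G : Type) (n : ℕ) : AddCommGroup (P G n) :=
  inferInstanceAs (AddCommGroup ((Fin (n + 1) → G) →₀ ℤ))

/-- Basis elements of the bar resolution. -/
noncomputable def P.of {G : Type} {n : ℕ} (v : Fin (n + 1) → G) : P G n := Finsupp.single v (1 : ℤ)

/-- Additive maps out of the bar resolution. -/
noncomputable def P.lift {G : Type} {n : ℕ} {M : Type*} [AddCommGroup M]
    (b : (Fin (n + 1) → G) → M) : P G n →+ M :=
  Finsupp.liftAddHom (fun v => (zmultiplesHom M) (b v))

@[simp] lemma P.lift_of {G : Type} {n : ℕ} {M : Type*} [AddCommGroup M]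
    (b : (Fin (n + 1) → G) → M) (v : Fin (n + 1) → G) : P.lift b (P.of v) = b v := by
  refine (Finsupp.liftAddHom_apply_single _ _ _).trans ?_
  simp

lemma P.ext {G : Type} {n : ℕ} {M : Type*} [AddCommGroup M] {f g : P G n →+ M}
    (h : ∀ v, f (P.of v) = g (P.of v)) : f = g := by
  apply Finsupp.addHom_ext'
  intro v
  apply AddMonoidHom.ext_int
  exact h v

lemma P.ext' {G : Type} {n : ℕ} {M : Type*} [AddCommGroup M] {f g : P G n →+ M}
    (h : ∀ v, f (P.of v) = g (P.of v)) (x : P G n) : f x = g x := by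
  rw [P.ext h]

section
variable {G : Type} [Group G]

/-- Action of `G` on tuples: multiply the zeroth entry. -/
def act {n : ℕ} (g : G) (v : Fin (n + 1) → G) : Fin (n + 1) → G :=
  Fin.cons (g * v 0) (Fin.tail v)

lemma act_one {n : ℕ} (v : Fin (n + 1) → G) : act 1 v = v := by
  simp [act]

lemma act_mul {n : ℕ} (g h : G) (v : Fin (n + 1) → G) : act (g * h) v = act g (act h v) := by
  simp [act, mul_assoc]

noncomputable instance {n : ℕ} : DistribMulAction G (P G n) where
  smul g x := P.lift (fun v => P.of (act g v)) x
  one_smul x := by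
    change P.lift (fun v => P.of (act 1 v)) x = AddMonoidHom.id _ x
    apply P.ext'
    simp [act_one]
  mul_smul g h x := by
    change P.lift _ x = ((P.lift (fun v => P.of (act g v))).comp (P.lift (fun v => P.of (act h v)))) x
    apply P.ext'
    simp [act_mul]
  smul_zero g := map_zero _
  smul_add g := map_add _

lemma P.smul_of {n : ℕ} (g : G) (v : Fin (n + 1) → G) : g • (P.of v : P G n) = P.of (act g v) :=
  P.lift_of _ _

lemma P.map_smul {M : Type*} [AddCommGroup M] [DistribMulAction G M] {n : ℕ} (f : P G n →+ M) (g : G)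
    (h : ∀ v, f (P.of (act g v)) = g • f (P.of v)) (x : P G n) : f (g • x) = g • f x := by
  change (f.comp (DistribSMul.toAddMonoidHom _ g)) x =
    ((DistribSMul.toAddMonoidHom _ g).comp f) x
  apply P.ext'
  intro v
  simp [P.smul_of, h]

lemma contractNth_act {n : ℕ} (j : Fin (n + 2)) (g : G) (v : Fin (n + 2) → G) :
    Fin.contractNth j (· * ·) (act g v) = act g (Fin.contractNth j (· * ·) v) := by
  ext k
  refine Fin.cases ?_ (fun k => ?_) k
  · simp only [act, Fin.cons_zero, Fin.contractNth, Fin.castSucc_zero, Fin.cons_succ, Fin.tail]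
    split_ifs with h1 h2
    · rfl
    · simp [mul_assoc]
    · exfalso; simp only [Fin.val_zero] at h1 h2; omega
  · simp only [act, Fin.cons_succ, Fin.contractNth, Fin.tail, ← Fin.succ_castSucc]

lemma contractNth_zero_cons {n : ℕ} (v : Fin (n + 1) → G) :
    Fin.contractNth 0 (· * ·) (Fin.cons 1 v : Fin (n + 2) → G) = v := by
  ext k
  refine Fin.cases ?_ (fun k => ?_) k
  · simp [Fin.contractNth]
  · simp [Fin.contractNth]

lemma contractNth_succ_cons {n : ℕ} (j : Fin (n + 2)) (v : Fin (n + 2) → G) :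
    Fin.contractNth j.succ (· * ·) (Fin.cons 1 v : Fin (n + 3) → G) =
      Fin.cons 1 (Fin.contractNth j (· * ·) v) := by
  ext k
  refine Fin.cases ?_ (fun k => ?_) k
  · simp [Fin.contractNth]
  · simp [Fin.contractNth]

/-- The differential of the bar resolution. -/
noncomputable def dP {n : ℕ} : P G (n + 1) →+ P G n :=
  P.lift (fun v => ∑ j : Fin (n + 2), (-1 : ℤ) ^ (j : ℕ) • P.of (Fin.contractNth j (· * ·) v))

lemma dP_of {n : ℕ} (v : Fin (n + 2) → G) : dP (P.of v) =
    ∑ j : Fin (n + 2), (-1 : ℤ) ^ (j : ℕ) • P.of (Fin.contractNth j (· * ·) v) := P.lift_of _ _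

lemma dP_smul {n : ℕ} (g : G) (x : P G (n + 1)) : dP (g • x) = g • dP x := by
  apply P.map_smul
  intro v
  rw [dP_of, dP_of, Finset.smul_sum]
  refine Finset.sum_congr rfl fun j _ => ?_
  rw [smul_comm, P.smul_of, contractNth_act]

/-- The augmentation. -/
noncomputable def eps : P G 0 →+ ℤ := P.lift (fun _ => 1)

lemma eps_smul (g : G) (x : P G 0) : eps (g • x) = eps x := by
  change (eps.comp (DistribSMul.toAddMonoidHom _ g)) x = eps x
  apply P.ext'
  intro v
  simp [P.smul_of, eps]

lemma eps_dP (x : P G 1) : eps (dP x) = 0 := by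
  change (eps.comp dP) x = (0 : P G 1 →+ ℤ) x
  apply P.ext'
  intro v
  simp [dP_of, eps, Fin.sum_univ_two]

/-- The contracting homotopy. -/
noncomputable def sP {n : ℕ} : P G n →+ P G (n + 1) := P.lift (fun v => P.of (Fin.cons 1 v))

lemma sP_of {n : ℕ} (v : Fin (n + 1) → G) : sP (P.of v) = P.of (Fin.cons 1 v) := P.lift_of _ _

lemma dP_sP {n : ℕ} (x : P G (n + 1)) : dP (sP x) + sP (dP x) = x := by
  change (dP.comp sP + sP.comp dP : P G (n + 1) →+ P G (n + 1)) x = AddMonoidHom.id _ x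
  apply P.ext'
  intro v
  simp only [AddMonoidHom.add_apply, AddMonoidHom.comp_apply, sP_of, dP_of, map_sum, map_zsmul,
    AddMonoidHom.id_apply]
  rw [Fin.sum_univ_succ, contractNth_zero_cons]
  simp only [contractNth_succ_cons, Fin.val_succ, pow_succ, mul_neg, mul_one, neg_smul,
    Finset.sum_neg_distrib]
  simp

lemma dP_sP_zero (x : P G 0) : dP (sP x) = x - eps x • P.of (fun _ => 1) := by
  change (dP.comp sP) x = (AddMonoidHom.id _ - ((zmultiplesHom _) (P.of (fun _ => 1))).comp eps : P G 0 →+ P G 0) x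
  apply P.ext'
  intro v
  simp only [AddMonoidHom.comp_apply, sP_of, dP_of]
  rw [Fin.sum_univ_succ, contractNth_zero_cons]
  simp only [eps, AddMonoidHom.sub_apply, AddMonoidHom.comp_apply, P.lift_of,
    AddMonoidHom.id_apply]
  simp [sub_eq_add_neg]
  congr 1
  ext k
  obtain rfl := Subsingleton.elim k 0
  simp [Fin.contractNth]

lemma P.of_eq {n : ℕ} (v : Fin (n + 2) → G) : (P.of v : P G (n + 1)) = v 0 • sP (P.of (Fin.tail v)) := by
  rw [sP_of, P.smul_of]
  simp [act]

lemma dP_dP {n : ℕ} (x : P G (n + 2)) : dP (dP x) = 0 := by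
  induction n with
  | zero =>
    change (dP.comp dP) x = (0 : P G 2 →+ _) x
    apply P.ext'
    intro v
    simp only [AddMonoidHom.comp_apply, P.of_eq v, dP_smul, AddMonoidHom.zero_apply]
    rw [eq_sub_of_add_eq (dP_sP (P.of (Fin.tail v))), map_sub, dP_sP_zero, eps_dP]
    simp
  | succ n ih =>
    change (dP.comp dP) x = (0 : P G (n + 3) →+ _) x
    apply P.ext'
    intro v
    simp only [AddMonoidHom.comp_apply, P.of_eq v, dP_smul, AddMonoidHom.zero_apply]
    rw [eq_sub_of_add_eq (dP_sP (P.of (Fin.tail v))), map_sub, eq_sub_of_add_eq (dP_sP (dP _)), ih]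
    simp

lemma dP_exact {n : ℕ} {x : P G (n + 1)} (h : dP x = 0) : dP (sP x) = x := by
  have := dP_sP x
  simpa [h] using this

lemma dP_exact_zero {x : P G 0} (h : eps x = 0) : dP (sP x) = x := by
  rw [dP_sP_zero, h]; simp

end

end PSq


namespace PSq
section
open CategoryTheory
variable {G : Type} [Group G]

/-- The coefficient representation. -/
abbrev ZZ (G : Type) [Group G] := Rep.trivial ℤ G ℤ

lemma pi_zero_iff {n : ℕ} (z : groupCohomology.cocycles (ZZ G) (n + 1)) :
    groupCohomology.π (ZZ G) (n + 1) z = 0 ↔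
      ∃ y : (Fin n → G) → ℤ, groupCohomology.toCocycles (ZZ G) n (n + 1) y = z := by
  have hex : (ShortComplex.mk _ _ ((groupCohomology.inhomogeneousCochains (ZZ G)).toCycles_comp_homologyπ n (n + 1))).Exact :=
    ShortComplex.exact_of_g_is_cokernel _
      ((groupCohomology.inhomogeneousCochains (ZZ G)).homologyIsCokernel n (n + 1) (by simp))
  constructor
  · intro h
    exact (ShortComplex.moduleCat_exact_iff _).1 hex z h
  · rintro ⟨y, rfl⟩
    have := (groupCohomology.inhomogeneousCochains (ZZ G)).toCycles_comp_homologyπ n (n + 1)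
    exact congrArg (fun f => f.hom y) this

/-- inhomogeneous differential -/
def dI {n : ℕ} (f : (Fin n → G) → ℤ) : (Fin (n + 1) → G) → ℤ := fun g =>
  f (fun i => g i.succ) + ∑ j : Fin (n + 1), (-1 : ℤ) ^ ((j : ℕ) + 1) * f (Fin.contractNth j (· * ·) g)

lemma d_eq_dI {n : ℕ} (f : (Fin n → G) → ℤ) :
    inhomogeneousCochains.d (ZZ G) n f = dI f := by
  ext g
  refine (inhomogeneousCochains.d_hom_apply (ZZ G) n f g).trans ?_
  simp [dI]

/-- Homogenization of a cochain. -/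
noncomputable def toF {n : ℕ} (f : (Fin n → G) → ℤ) : P G n →+ ℤ := P.lift (fun v => f (Fin.tail v))

lemma toF_smul {n : ℕ} (f : (Fin n → G) → ℤ) (g : G) (x : P G n) : toF f (g • x) = toF f x := by
  change ((toF f).comp (DistribSMul.toAddMonoidHom _ g)) x = toF f x
  apply P.ext'
  intro v
  simp [P.smul_of, toF, act]

lemma eq_toF {n : ℕ} (F : P G n →+ ℤ) (hF : ∀ (g : G) x, F (g • x) = F x) :
    F = toF (fun v => F (P.of (Fin.cons 1 v))) := by
  apply P.ext
  intro v
  have : (P.of v : P G n) = v 0 • P.of (Fin.cons 1 (Fin.tail v)) := by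
    rw [P.smul_of]; simp [act]
  conv_lhs => rw [this, hF]
  simp [toF]

lemma toF_dP {n : ℕ} (f : (Fin n → G) → ℤ) (x : P G (n + 1)) : toF f (dP x) = toF (dI f) x := by
  suffices h : (toF f).comp dP = toF (dI f) from DFunLike.congr_fun h x
  have hinv : ∀ (g : G) (x : P G (n + 1)), ((toF f).comp dP) (g • x) = ((toF f).comp dP) x := by
    intro g x
    simp [dP_smul, toF_smul]
  rw [eq_toF _ hinv]
  congr 1
  ext v
  simp only [AddMonoidHom.comp_apply, dP_of, map_sum, map_zsmul]
  rw [Fin.sum_univ_succ, contractNth_zero_cons]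
  simp only [dI, toF, P.lift_of, Fin.val_zero, pow_zero, smul_eq_mul]
  refine congrArg₂ (· + ·) ?_ (Finset.sum_congr rfl fun j _ => ?_)
  · simp [Fin.tail_def]
  rw [Fin.val_succ]
  congr 2
  ext k
  simp [Fin.tail, Fin.contractNth]

lemma toF_injective {n : ℕ} {f g : (Fin n → G) → ℤ} (h : toF f = toF g) : f = g := by
  ext v
  have := DFunLike.congr_fun h (P.of (Fin.cons 1 v))
  simpa [toF] using this

/-- `F` represents the class `χ`. -/
def Represents {n : ℕ} (F : P G (n + 1) →+ ℤ) (χ : groupCohomology (ZZ G) (n + 1)) : Prop :=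
  ∀ m : ℕ, (m • χ = 0 ↔ ∃ ψ : P G n →+ ℤ, (∀ (g : G) x, ψ (g • x) = ψ x) ∧
    ∀ x, m • F x = ψ (dP x))

lemma represents_pi {n : ℕ} (z : groupCohomology.cocycles (ZZ G) (n + 1)) :
    Represents (toF (groupCohomology.iCocycles (ZZ G) (n + 1) z : (Fin (n + 1) → G) → ℤ))
      (groupCohomology.π (ZZ G) (n + 1) z) := by
  intro m
  have hinj : Function.Injective (groupCohomology.iCocycles (ZZ G) (n + 1)) :=
    (ModuleCat.mono_iff_injective _).1 inferInstance
  have hto : ∀ y : (Fin n → G) → ℤ, groupCohomology.iCocycles (ZZ G) (n + 1)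
      (groupCohomology.toCocycles (ZZ G) n (n + 1) y) = dI y := by
    intro y
    have h1 := (groupCohomology.inhomogeneousCochains (ZZ G)).toCycles_i n (n + 1)
    rw [groupCohomology.inhomogeneousCochains.d_def] at h1
    rw [← d_eq_dI]
    exact congrArg (fun f => f.hom y) h1
  rw [← map_nsmul, pi_zero_iff]
  constructor
  · rintro ⟨y, hy⟩
    refine ⟨toF y, fun g x => toF_smul _ _ _, fun x => ?_⟩
    rw [toF_dP, ← hto, hy, map_nsmul]
    change (m • toF _) x = _
    congr 1
    apply P.ext
    intro v
    simp [toF]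
  · rintro ⟨ψ, hψ, h⟩
    refine ⟨fun v => ψ (P.of (Fin.cons 1 v)), ?_⟩
    apply hinj
    rw [hto, map_nsmul]
    apply toF_injective
    ext x
    rw [← toF_dP, ← eq_toF ψ hψ, ← h]
    change (m • toF _) x = _
    congr 1
    apply P.ext
    intro v
    simp [toF]

lemma exists_rep {n : ℕ} (χ : groupCohomology (ZZ G) (n + 1)) :
    ∃ F : P G (n + 1) →+ ℤ, (∀ (g : G) x, F (g • x) = F x) ∧ (∀ x, F (dP x) = 0) ∧ Represents F χ := by
  induction χ using groupCohomology_induction_on with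
  | h z =>
    refine ⟨_, fun g x => toF_smul _ _ _, fun x => ?_, represents_pi z⟩
    rw [toF_dP, ← d_eq_dI]
    have h1 := (groupCohomology.inhomogeneousCochains (ZZ G)).iCycles_d (n + 1) (n + 2)
    rw [groupCohomology.inhomogeneousCochains.d_def] at h1
    have h2 : inhomogeneousCochains.d (ZZ G) (n + 1) (groupCohomology.iCocycles (ZZ G) (n + 1) z) = 0 :=
      congrArg (fun f => f.hom z) h1
    rw [h2]
    change (P.lift (fun _ => (0 : ℤ))) x = (0 : P G (n + 2) →+ ℤ) x
    apply P.ext'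
    simp

lemma exists_class {n : ℕ} (F : P G (n + 1) →+ ℤ) (hF : ∀ (g : G) x, F (g • x) = F x)
    (hd : ∀ x, F (dP x) = 0) : ∃ χ : groupCohomology (ZZ G) (n + 1), Represents F χ := by
  have h0 : inhomogeneousCochains.d (ZZ G) (n + 1) (fun v => F (P.of (Fin.cons 1 v))) = 0 := by
    rw [d_eq_dI]
    apply toF_injective
    ext x
    rw [← toF_dP, ← eq_toF F hF, hd]
    change (0 : P G (n + 2) →+ ℤ) x = (P.lift (fun _ => (0 : ℤ))) x
    apply P.ext'
    simp
  refine ⟨groupCohomology.π (ZZ G) (n + 1) (groupCohomology.cocyclesMk _ h0), ?_⟩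
  have := represents_pi (groupCohomology.cocyclesMk _ h0)
  rw [groupCohomology.iCocycles_mk] at this
  rwa [← eq_toF F hF] at this

lemma h_zero_torsionFree (χ : groupCohomology (ZZ G) 0) (m : ℕ) (hm : m ≠ 0) (h : m • χ = 0) :
    χ = 0 := by
  have e := (groupCohomology.H0Iso (ZZ G)).toLinearEquiv
  apply e.injective
  rw [map_zero]
  have h2 : m • e χ = 0 := by rw [← map_nsmul, h, map_zero]
  ext
  have h3 := congrArg Subtype.val h2
  have h4 : m • ((e χ).1 : ℤ) = 0 := h3
  have := (smul_eq_zero.1 h4).resolve_left hm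
  exact this

end
end PSq


namespace PSq
section
variable {G : Type} [Group G]

lemma exists_lift {j : ℕ} (H : Subgroup G) (η : G → G) (hη : ∀ g, η g ∈ H)
    (hη' : ∀ h ∈ H, ∀ g, η (h * g) = h * η g) {M M' : Type*} [AddCommGroup M] [AddCommGroup M']
    [DistribMulAction G M] [DistribMulAction G M'] (dM : M →+ M')
    (hdM : ∀ h ∈ H, ∀ x, dM (h • x) = h • dM x)
    (θ : P G j →+ M') (hθ : ∀ h ∈ H, ∀ x, θ (h • x) = h • θ x)
    (S : AddSubgroup M) (hS : ∀ h ∈ H, ∀ x ∈ S, h • x ∈ S)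
    (hex : ∀ v, ∃ y ∈ S, dM y = θ (P.of v)) :
    ∃ θ' : P G j →+ M, (∀ h ∈ H, ∀ x, θ' (h • x) = h • θ' x) ∧ (∀ x, θ' x ∈ S) ∧
      ∀ x, dM (θ' x) = θ x := by
  choose y hyS hy using hex
  refine ⟨P.lift (fun v => η (v 0) • y (act (η (v 0))⁻¹ v)), ?_, ?_, ?_⟩
  · intro h hh x
    apply P.map_smul
    intro v
    have h0 : act h v 0 = h * v 0 := by simp [act]
    rw [P.lift_of, P.lift_of, h0, hη' h hh, ← act_mul, smul_smul]
    congr 3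
    group
  · intro x
    suffices h : ((QuotientAddGroup.mk' S).comp
        (P.lift (fun v => η (v 0) • y (act (η (v 0))⁻¹ v)))) x = (0 : P G j →+ M ⧸ S) x by
      simpa using h
    apply P.ext'
    intro v
    simpa using hS _ (hη _) _ (hyS _)
  · intro x
    change (dM.comp (P.lift _)) x = θ x
    apply P.ext'
    intro v
    rw [AddMonoidHom.comp_apply, P.lift_of, hdM _ (hη _), hy, ← hθ _ (hη _), P.smul_of, ← act_mul]
    simp [act_one]

/-- The order of a finite group kills its cohomology in positive degrees. -/
lemma card_smul_coboundary [Finite G] {n : ℕ} (F : P G (n + 1) →+ ℤ)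
    (hF : ∀ (g : G) x, F (g • x) = F x) (hd : ∀ x, F (dP x) = 0) :
    ∃ ψ : P G n →+ ℤ, (∀ (g : G) x, ψ (g • x) = ψ x) ∧ ∀ x, Nat.card G • F x = ψ (dP x) := by
  have := Fintype.ofFinite G
  refine ⟨∑ g : G, (F.comp sP).comp (DistribSMul.toAddMonoidHom _ g), ?_, ?_⟩
  · intro h x
    simp only [AddMonoidHom.finsetSum_apply, AddMonoidHom.comp_apply,
      DistribSMul.toAddMonoidHom_apply, smul_smul]
    exact Fintype.sum_equiv (Equiv.mulRight h) _ _ (fun g => rfl)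
  · intro x
    simp only [AddMonoidHom.finsetSum_apply, AddMonoidHom.comp_apply,
      DistribSMul.toAddMonoidHom_apply]
    have : ∀ g : G, F (sP (g • dP x)) = F x := by
      intro g
      rw [← dP_smul, eq_sub_of_add_eq' (dP_sP (g • x)), map_sub, hd, hF, sub_zero]
    simp [this]

/-- Functoriality of the bar resolution. -/
noncomputable def mapP {G' : Type} [Group G'] {n : ℕ} (r : G →* G') : P G n →+ P G' n :=
  P.lift (fun v => P.of (r ∘ v))

lemma mapP_of {G' : Type} [Group G'] {n : ℕ} (r : G →* G') (v : Fin (n + 1) → G) :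
    mapP r (P.of v) = P.of (r ∘ v) := P.lift_of _ _

lemma mapP_smul {G' : Type} [Group G'] {n : ℕ} (r : G →* G') (g : G) (x : P G n) :
    mapP r (g • x) = r g • mapP r x := by
  change ((mapP r).comp (DistribSMul.toAddMonoidHom _ g)) x =
    ((DistribSMul.toAddMonoidHom _ (r g)).comp (mapP r)) x
  apply P.ext'
  intro v
  simp only [AddMonoidHom.comp_apply, DistribSMul.toAddMonoidHom_apply, P.smul_of, mapP_of]
  congr 1
  ext k
  refine Fin.cases ?_ (fun k => ?_) k
  · simp [act]
  · simp [act, Fin.tail]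

lemma mapP_dP {G' : Type} [Group G'] {n : ℕ} (r : G →* G') (x : P G (n + 1)) :
    mapP r (dP x) = dP (mapP r x) := by
  change ((mapP r).comp dP) x = (dP.comp (mapP r)) x
  apply P.ext'
  intro v
  simp only [AddMonoidHom.comp_apply, dP_of, mapP_of, map_sum, map_zsmul]
  refine Finset.sum_congr rfl fun j _ => ?_
  rw [Fin.comp_contractNth (opβ := (· * ·))]
  intro a b; exact map_mul r a b

lemma eps_mapP {G' : Type} [Group G'] (r : G →* G') (x : P G 0) :
    eps (mapP r x) = eps x := by
  change (eps.comp (mapP r)) x = eps x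
  apply P.ext'
  intro v
  simp [mapP_of, eps]

lemma mapP_comp {G' G'' : Type} [Group G'] [Group G''] {n : ℕ} (r : G →* G') (r' : G' →* G'')
    (x : P G n) : mapP (r'.comp r) x = mapP r' (mapP r x) := by
  change _ = ((mapP r').comp (mapP r)) x
  apply P.ext'
  intro v
  simp [mapP_of, Function.comp_assoc]

lemma exists_homotopy (H : Subgroup G) (r : G →* G) (hr : ∀ h ∈ H, r h = h) (hr' : ∀ g, r g ∈ H)
    (n : ℕ) : ∃ k : P G n →+ P G (n + 1), (∀ h ∈ H, ∀ x, k (h • x) = h • k x) ∧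
      ∀ x, dP (k (dP x)) = mapP r (dP x) - dP x := by
  have hη' : ∀ h ∈ H, ∀ g, r (h * g) = h * r g := by
    intro h hh g; rw [map_mul, hr h hh]
  have hdd : ∀ (j : ℕ), ∀ h ∈ H, ∀ x : P G (j + 1), dP (h • x) = h • dP x :=
    fun j h _ x => dP_smul h x
  induction n with
  | zero =>
    obtain ⟨k, hk, -, hk'⟩ := exists_lift (j := 0) H r hr' hη' (dP : P G 1 →+ P G 0) (hdd 0)
      (mapP r - AddMonoidHom.id _)
      (by intro h hh x; simp [mapP_smul, hr h hh, smul_sub]) ⊤ (by simp)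
      (by
        intro v
        refine ⟨sP _, trivial, dP_exact_zero ?_⟩
        simp [eps_mapP])
    exact ⟨k, hk, fun x => by rw [hk']; simp⟩
  | succ n ih =>
    obtain ⟨k₀, hk₀, hk₀'⟩ := ih
    obtain ⟨k, hk, -, hk'⟩ := exists_lift (j := n + 1) H r hr' hη' (dP : P G (n + 2) →+ P G (n + 1))
      (hdd _) (mapP r - AddMonoidHom.id _ - k₀.comp dP)
      (by intro h hh x; simp [mapP_smul, hr h hh, smul_sub, dP_smul, hk₀ h hh]) ⊤ (by simp)
      (by
        intro v
        refine ⟨sP _, trivial, dP_exact ?_⟩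
        simp [hk₀', mapP_dP])
    exact ⟨k, hk, fun x => by rw [hk']; simp [dP_dP]⟩

/-- Inductive step for elementary abelian groups. -/
lemma elem_step (p : ℕ) (hcomm : ∀ a b : G, a * b = b * a) (H : Subgroup G) (r : G →* H)
    (hr : ∀ h : H, r h = h) (σ : G) (hσ : σ ^ p = 1) (hrσ : r σ = 1)
    (hgen : ∀ g : G, ∃ i : ℕ, g = r g * σ ^ i)
    {n : ℕ} (ih : ∀ (F : P H (n + 1) →+ ℤ), (∀ (g : H) x, F (g • x) = F x) → (∀ x, F (dP x) = 0) →
      ∃ ψ : P H n →+ ℤ, (∀ (g : H) x, ψ (g • x) = ψ x) ∧ ∀ x, p • F x = ψ (dP x))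
    (F : P G (n + 1) →+ ℤ) (hF : ∀ (g : G) x, F (g • x) = F x) (hd : ∀ x, F (dP x) = 0) :
    ∃ ψ : P G n →+ ℤ, (∀ (g : G) x, ψ (g • x) = ψ x) ∧ ∀ x, p • F x = ψ (dP x) := by
  obtain ⟨ψ₂, hψ₂, hψ₂'⟩ := ih (F.comp (mapP H.subtype))
    (by intro g x; simp [mapP_smul, hF]) (by intro x; simp [mapP_dP, hd])
  obtain ⟨k, hk, hk'⟩ := exists_homotopy H (H.subtype.comp r) (by
    intro h hh; simpa using congrArg Subtype.val (hr ⟨h, hh⟩)) (by simp) n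
  have h1 : ∀ x : P G (n + 1), F (k (dP x)) = F (mapP (H.subtype.comp r) x) - F x := by
    intro x
    have h2 : dP (mapP (H.subtype.comp r) x - x - k (dP x)) = 0 := by
      rw [map_sub, hk', map_sub, mapP_dP, sub_self]
    have h3 := hd (sP (mapP (H.subtype.comp r) x - x - k (dP x)))
    rw [dP_exact h2, map_sub, map_sub, sub_eq_zero] at h3
    exact h3.symm
  set Ψ : P G n →+ ℤ := ∑ i ∈ Finset.range p,
    (F.comp k).comp (DistribSMul.toAddMonoidHom _ (σ ^ i)) with hΨ
  have hΨa : ∀ x, Ψ x = ∑ i ∈ Finset.range p, F (k (σ ^ i • x)) := by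
    intro x; simp [hΨ]
  have hΨσ : ∀ x, Ψ (σ • x) = Ψ x := by
    intro x
    rw [hΨa, hΨa]
    simp only [smul_smul, ← pow_succ]
    have e1 := Finset.sum_range_succ (fun i => F (k (σ ^ i • x))) p
    have e2 := Finset.sum_range_succ' (fun i => F (k (σ ^ i • x))) p
    simp only [hσ, pow_zero] at e1 e2
    linarith
  have hΨσi : ∀ (i : ℕ) x, Ψ (σ ^ i • x) = Ψ x := by
    intro i x
    induction i with
    | zero => simp
    | succ i ih => rw [pow_succ', mul_smul, hΨσ, ih]
  have hΨh : ∀ h ∈ H, ∀ x, Ψ (h • x) = Ψ x := by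
    intro h hh x
    rw [hΨa, hΨa]
    refine Finset.sum_congr rfl fun i _ => ?_
    rw [smul_smul, hcomm, mul_smul, hk h hh, hF]
  have hΨg : ∀ (g : G) x, Ψ (g • x) = Ψ x := by
    intro g x
    obtain ⟨i, hi⟩ := hgen g
    rw [hi, mul_smul, hΨh _ (r g).2, hΨσi]
  refine ⟨ψ₂.comp (mapP r) - Ψ, ?_, ?_⟩
  · intro g x
    simp [mapP_smul, hψ₂, hΨg]
  · intro x
    rw [AddMonoidHom.sub_apply, AddMonoidHom.comp_apply, mapP_dP, ← hψ₂', hΨa]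
    have : ∀ i, F (k (σ ^ i • dP x)) = F (mapP H.subtype (mapP r x)) - F x := by
      intro i
      rw [← dP_smul, h1, hF, mapP_smul, mapP_comp, map_pow]
      simp [hrσ]
    simp only [this, AddMonoidHom.comp_apply, Finset.sum_const, Finset.card_range]
    rw [nsmul_sub]; ring

lemma exists_functional (p : ℕ) [Fact p.Prime] (V : Type) [AddCommGroup V] [Module (ZMod p) V]
    (v₀ : V) (h : v₀ ≠ 0) : ∃ (f : V →+ ZMod p) (v : V), f v = 1 := by
  have hex : ∃ f : Module.Dual (ZMod p) V, f v₀ ≠ 0 := by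
    by_contra hcon
    push Not at hcon
    exact h ((Module.forall_dual_apply_eq_zero_iff (ZMod p) _).1 hcon)
  obtain ⟨f, hf⟩ := hex
  exact ⟨f.toAddMonoidHom, (f v₀)⁻¹ • v₀, by simp [hf]⟩

lemma elem_split_comm {G : Type} [_inst : CommGroup G] (p : ℕ) [Fact p.Prime] (hpow : ∀ g : G, g ^ p = 1)
    (hne : ∃ g : G, g ≠ 1) :
    ∃ (H : Subgroup G) (r : G →* H) (σ : G), H ≠ ⊤ ∧ (∀ h : H, r h = h) ∧ σ ^ p = 1 ∧ r σ = 1 ∧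
      ∀ g : G, ∃ i : ℕ, g = r g * σ ^ i := by
  obtain ⟨g₀, hg₀⟩ := hne
  obtain ⟨f', v, hv'⟩ := @exists_functional p _ (Additive G) _
    (AddCommGroup.zmodModule (n := p) (fun x => congrArg Additive.ofMul (hpow x.toMul)))
    (Additive.ofMul g₀) (fun h => hg₀ (Additive.ofMul.injective h))
  obtain ⟨σ, rfl⟩ := Additive.ofMul.surjective v
  obtain ⟨f, hf1, hfm, hσ⟩ : ∃ f : G → ZMod p, f 1 = 0 ∧ (∀ a b, f (a * b) = f a + f b) ∧ f σ = 1 :=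
    ⟨fun g => f' (Additive.ofMul g), by simp, by simp, hv'⟩
  let χ : G →* Multiplicative (ZMod p) :=
    { toFun := fun g => Multiplicative.ofAdd (f g)
      map_one' := by simp [hf1]
      map_mul' := by simp [hfm] }
  have hH : ∀ g : G, g ∈ χ.ker ↔ f g = 0 := fun g => Iff.rfl
  have hfi : ∀ a, f a⁻¹ = - f a := by
    intro a
    rw [eq_neg_iff_add_eq_zero, ← hfm, inv_mul_cancel, hf1]
  have hfp : ∀ i : ℕ, f (σ ^ i) = i := by
    intro i
    induction i with
    | zero => simp [hf1]
    | succ i ih => rw [pow_succ, hfm, ih, hσ]; push_cast; rfl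
  have hpw : ∀ a b : ZMod p, σ ^ (a + b).val = σ ^ a.val * σ ^ b.val := by
    intro a b
    rw [← pow_add, ZMod.val_add]
    conv_rhs => rw [← Nat.mod_add_div (a.val + b.val) p, pow_add, pow_mul, hpow, one_pow, mul_one]
  let r : G →* χ.ker :=
    { toFun := fun g => ⟨g * (σ ^ (f g).val)⁻¹, by rw [hH, hfm, hfi, hfp]; simp⟩
      map_one' := by ext; simp [hf1]
      map_mul' := fun a b => by
        ext
        simp only [hfm, hpw, Subgroup.coe_mul, mul_inv]
        exact mul_mul_mul_comm _ _ _ _ }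
  have hrdef : ∀ g, ((r g : χ.ker) : G) = g * (σ ^ (f g).val)⁻¹ := fun g => rfl
  refine ⟨χ.ker, r, σ, ?_, ?_, hpow _, ?_, ?_⟩
  · intro h
    have : σ ∈ χ.ker := by rw [h]; trivial
    rw [hH, hσ] at this
    exact one_ne_zero this
  · intro h
    ext
    rw [hrdef, (hH _).1 h.2]; simp
  · ext
    rw [hrdef, hσ, ZMod.val_one]; simp
  · intro g
    exact ⟨(f g).val, by rw [hrdef]; simp⟩

lemma elem_split (p : ℕ) [Fact p.Prime] (hG : IsElementaryAbelian p G) (hne : ∃ g : G, g ≠ 1) :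
    ∃ (H : Subgroup G) (r : G →* H) (σ : G), H ≠ ⊤ ∧ (∀ h : H, r h = h) ∧ σ ^ p = 1 ∧ r σ = 1 ∧
      ∀ g : G, ∃ i : ℕ, g = r g * σ ^ i :=
  elem_split_comm (G := G) (_inst := { mul_comm := hG.1 }) p hG.2 hne

lemma elem_kill (p : ℕ) (hp : p.Prime) (N : ℕ) : ∀ (G : Type) [Group G] [Finite G],
    Nat.card G ≤ N → IsElementaryAbelian p G → ∀ (n : ℕ)
    (F : P G (n + 1) →+ ℤ) (_ : ∀ (g : G) x, F (g • x) = F x) (_ : ∀ x, F (dP x) = 0),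
    ∃ ψ : P G n →+ ℤ, (∀ (g : G) x, ψ (g • x) = ψ x) ∧ ∀ x, p • F x = ψ (dP x) := by
  have := Fact.mk hp
  induction N with
  | zero =>
    intro G _ _ h
    have := Nat.card_pos (α := G)
    omega
  | succ N ih =>
    intro G _ _ hc hG n F hF hd
    by_cases hne : ∃ g : G, g ≠ 1
    · obtain ⟨H, r, σ, hH, hr, hσ, hrσ, hgen⟩ := elem_split p hG hne
      refine elem_step p hG.1 H r hr σ hσ hrσ hgen ?_ F hF hd
      refine ih H ?_ ⟨fun a b => Subtype.ext (hG.1 a b), fun g => Subtype.ext (hG.2 g)⟩ n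
      have h1 : Nat.card H < Nat.card G := by
        refine lt_of_le_of_ne (Subgroup.card_le_card_group H) fun h => hH ?_
        exact Subgroup.eq_top_of_card_eq H h
      omega
    · push Not at hne
      obtain ⟨ψ, h1, h2⟩ := card_smul_coboundary F hF hd
      have hs : Subsingleton G := ⟨fun a b => by rw [hne a, hne b]⟩
      have hcard : Nat.card G = 1 := Nat.card_of_subsingleton (1 : G)
      refine ⟨p • ψ, fun g x => by simp [h1], fun x => ?_⟩
      rw [AddMonoidHom.nsmul_apply, ← h2, hcard, one_smul]

lemma elem_main (p : ℕ) (hp : p.Prime) [Finite G] (hG : IsElementaryAbelian p G) (i : ℕ)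
    (χ : groupCohomology (Rep.trivial ℤ G ℤ) i) : addOrderOf χ ≠ p ^ 2 := by
  intro h
  cases i with
  | zero =>
    have h0 := h_zero_torsionFree χ (p ^ 2) (pow_ne_zero _ hp.ne_zero) (by rw [← h]; exact addOrderOf_nsmul_eq_zero χ)
    rw [h0, addOrderOf_zero] at h
    have := Nat.one_lt_pow (n := 2) (by norm_num) hp.one_lt
    omega
  | succ n =>
    obtain ⟨F, hF, hd, hrep⟩ := exists_rep χ
    have := (hrep p).2 (elem_kill p hp _ G le_rfl hG n F hF hd)
    have h2 := addOrderOf_dvd_of_nsmul_eq_zero this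
    rw [h] at h2
    have h3 := Nat.le_of_dvd hp.pos h2
    have := hp.one_lt
    nlinarith
end
end PSq


namespace PSq
section
variable {G : Type} [Group G]

/-- The operators `σ - 1` (odd `j`) and `N = ∑ σ^i` (even `j`). -/
noncomputable def opA {M : Type*} [AddCommGroup M] [DistribMulAction G M] (σ : G) (p : ℕ) (j : ℕ) :
    M →+ M :=
  if Even j then ∑ i ∈ Finset.range p, DistribSMul.toAddMonoidHom M (σ ^ i)
  else DistribSMul.toAddMonoidHom M σ - AddMonoidHom.id M

lemma opA_even {M : Type*} [AddCommGroup M] [DistribMulAction G M] (σ : G) (p : ℕ) {j : ℕ}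
    (h : Even j) (x : M) : opA σ p j x = ∑ i ∈ Finset.range p, σ ^ i • x := by
  simp [opA, h]

lemma opA_odd {M : Type*} [AddCommGroup M] [DistribMulAction G M] (σ : G) (p : ℕ) {j : ℕ}
    (h : ¬ Even j) (x : M) : opA σ p j x = σ • x - x := by
  simp [opA, h]

lemma opA_add_two {M : Type*} [AddCommGroup M] [DistribMulAction G M] (σ : G) (p : ℕ) (j : ℕ) :
    (opA σ p (j + 2) : M →+ M) = opA σ p j := by
  simp [opA, Nat.even_add]

lemma map_opA {M M' : Type*} [AddCommGroup M] [DistribMulAction G M] [AddCommGroup M']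
    [DistribMulAction G M'] (σ : G) (p : ℕ) (j : ℕ) (f : M →+ M')
    (hf : ∀ (g : G) x, f (g • x) = g • f x) (x : M) : f (opA σ p j x) = opA σ p j (f x) := by
  by_cases h : Even j
  · simp [opA_even _ _ h, hf]
  · simp [opA_odd _ _ h, hf]

lemma opA_smul {M : Type*} [AddCommGroup M] [DistribMulAction G M] (σ : G) (p : ℕ) (j : ℕ)
    (hσ : ∀ g : G, g * σ = σ * g) (g : G) (x : M) : opA σ p j (g • x) = g • opA σ p j x := by
  have hc : ∀ i : ℕ, σ ^ i * g = g * σ ^ i := fun i => ((show Commute σ g from (hσ g).symm).pow_left i).eq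
  by_cases h : Even j
  · simp [opA_even _ _ h, Finset.smul_sum, smul_smul, hc]
  · simp [opA_odd _ _ h, smul_sub, smul_smul, hσ]

lemma smul_norm {M : Type*} [AddCommGroup M] [DistribMulAction G M] (σ : G) (p : ℕ) (hp : σ ^ p = 1)
    (x : M) : ∑ i ∈ Finset.range p, σ ^ (i + 1) • x = ∑ i ∈ Finset.range p, σ ^ i • x := by
  have e1 := Finset.sum_range_succ (fun i => σ ^ i • x) p
  have e2 := Finset.sum_range_succ' (fun i => σ ^ i • x) p
  rw [hp] at e1
  rw [pow_zero] at e2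
  exact add_right_cancel (e2.symm.trans e1)

lemma opA_opA {M : Type*} [AddCommGroup M] [DistribMulAction G M] (σ : G) (p : ℕ) (hp : σ ^ p = 1)
    (j : ℕ) (x : M) : opA σ p (j + 1) (opA σ p j x) = 0 := by
  by_cases h : Even j
  · have h' : ¬ Even (j + 1) := by simpa [Nat.even_add_one] using h
    rw [opA_odd _ _ h', opA_even _ _ h, Finset.smul_sum]
    simp only [smul_smul, ← pow_succ']
    rw [smul_norm σ p hp, sub_self]
  · have h' : Even (j + 1) := by simpa [Nat.even_add_one] using h
    rw [opA_even _ _ h', opA_odd _ _ h]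
    simp only [smul_sub, smul_smul, ← pow_succ, Finset.sum_sub_distrib]
    rw [smul_norm σ p hp, sub_self]

lemma inv_opA_even {M : Type*} [AddCommGroup M] [DistribMulAction G M] (σ : G) (p : ℕ) {j : ℕ}
    (h : Even j) (ψ : M →+ ℤ) (hψ : ∀ (g : G) x, ψ (g • x) = ψ x) (x : M) :
    ψ (opA σ p j x) = p * ψ x := by
  simp [opA_even _ _ h, hψ]

lemma inv_opA_odd {M : Type*} [AddCommGroup M] [DistribMulAction G M] (σ : G) (p : ℕ) {j : ℕ}
    (h : ¬ Even j) (ψ : M →+ ℤ) (hψ : ∀ (g : G) x, ψ (g • x) = ψ x) (x : M) :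
    ψ (opA σ p j x) = 0 := by
  simp [opA_odd _ _ h, hψ]

/-- The periodic sequence of chains. -/
noncomputable def pseq (σ : G) (p : ℕ) : (j : ℕ) → P G j
  | 0 => P.of (fun _ => 1)
  | j + 1 => sP (opA σ p (j + 1) (pseq σ p j))

lemma eps_pseq (σ : G) (p : ℕ) : eps (pseq σ p 0) = 1 := by simp [pseq, eps]

lemma dP_pseq (σ : G) (p : ℕ) (hp : σ ^ p = 1) (j : ℕ) :
    dP (pseq σ p (j + 1)) = opA σ p (j + 1) (pseq σ p j) := by
  induction j with
  | zero =>
    rw [show pseq σ p (0 + 1) = sP (opA σ p (0 + 1) (pseq σ p 0)) from rfl, dP_exact_zero]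
    exact inv_opA_odd σ p (by simp) eps eps_smul _
  | succ j ih =>
    rw [show pseq σ p (j + 1 + 1) = sP (opA σ p (j + 1 + 1) (pseq σ p (j + 1))) from rfl, dP_exact]
    rw [map_opA σ p _ dP dP_smul, ih, opA_opA σ p hp]

/-- Homotopies from `g` to the identity. -/
def IsHtpy (σ : G) (p : ℕ) (g : G) (q : (j : ℕ) → P G j) : Prop :=
  q 0 = 0 ∧ ∀ j, g • pseq σ p j - pseq σ p j = opA σ p j (q j) + dP (q (j + 1))

lemma exists_htpy (σ : G) (p : ℕ) (hp : σ ^ p = 1) (hσ : ∀ g : G, g * σ = σ * g) (g : G) :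
    ∃ q, IsHtpy σ p g q := by
  let q : (j : ℕ) → P G j := fun j => Nat.rec (motive := fun j => P G j) 0
    (fun j qj => sP (g • pseq σ p j - pseq σ p j - opA σ p j qj)) j
  have hq : ∀ j, q (j + 1) = sP (g • pseq σ p j - pseq σ p j - opA σ p j (q j)) := fun j => rfl
  have hq0 : q 0 = 0 := rfl
  refine ⟨q, hq0, fun j => ?_⟩
  rw [← sub_eq_iff_eq_add']
  induction j with
  | zero =>
    rw [hq, dP_exact_zero]
    rw [hq0, map_zero, sub_zero, map_sub, eps_smul, sub_self]
  | succ j ih =>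
    rw [hq (j + 1), dP_exact]
    rw [map_sub, map_sub, dP_smul, dP_pseq σ p hp, map_opA σ p _ dP dP_smul, ← ih,
      ← opA_smul σ p _ hσ, ← map_sub, ← map_sub, sub_sub_cancel, opA_opA σ p hp]

lemma zero_htpy (σ : G) (p : ℕ) (hp : σ ^ p = 1) (r : (j : ℕ) → P G j) (h0 : r 0 = 0)
    (h : ∀ j, opA σ p j (r j) + dP (r (j + 1)) = 0) :
    ∃ s : (j : ℕ) → P G j, ∀ j, r j = dP (s (j + 1)) - opA σ p (j + 1) (s j) := by
  let s : (j : ℕ) → P G j := fun j => Nat.rec (motive := fun j => P G j) 0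
    (fun j sj => sP (r j + opA σ p (j + 1) sj)) j
  have hs : ∀ j, s (j + 1) = sP (r j + opA σ p (j + 1) (s j)) := fun j => rfl
  have hs0 : s 0 = 0 := rfl
  refine ⟨s, fun j => ?_⟩
  rw [eq_sub_iff_add_eq]
  symm
  induction j with
  | zero =>
    rw [hs, dP_exact_zero]
    rw [hs0, h0]; simp
  | succ j ih =>
    rw [hs (j + 1), dP_exact]
    have e := opA_opA σ p hp (j + 1) (s j)
    rw [map_add, map_opA σ p _ dP dP_smul, ih, map_add, e, add_zero, add_comm,
      show j + 1 + 1 = j + 2 from rfl, opA_add_two]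
    exact h j

lemma ladder (σ : G) (p : ℕ) [NeZero p] (hp : σ ^ p = 1) (hσ : ∀ g : G, g * σ = σ * g)
    (hχ : ∀ a : G → ZMod p, (∀ g h, a (g * h) = a g + a h) → a σ = 0)
    {m : ℕ} (hm : ¬ Even m) (F : P G (m + 1) →+ ℤ) (ψ : P G m →+ ℤ)
    (hψ : ∀ (g : G) x, ψ (g • x) = ψ x) (h : ∀ x, p • F x = ψ (dP x)) :
    (p : ℤ) ∣ F (pseq σ p (m + 1)) := by
  have hm' : Even (m + 1) := by simpa [Nat.even_add_one] using hm
  have hwd : ∀ g q q', IsHtpy σ p g q → IsHtpy σ p g q' → ((ψ (q m) : ℤ) : ZMod p) = (ψ (q' m) : ℤ) := by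
    intro g q q' hq hq'
    obtain ⟨s, hs⟩ := zero_htpy σ p hp (fun j => q j - q' j) (by simp [hq.1, hq'.1]) (by
      intro j
      have := (hq.2 j).symm.trans (hq'.2 j)
      simp only [map_sub]
      rw [sub_add_sub_comm, this, sub_self])
    have h1 := congrArg ψ (hs m)
    simp only [map_sub] at h1
    rw [← h, inv_opA_even σ p hm' ψ hψ] at h1
    rw [← sub_eq_zero, ← Int.cast_sub, h1]
    simp
  have hmul : ∀ g h q q', IsHtpy σ p g q → IsHtpy σ p h q' →
      IsHtpy σ p (g * h) (fun j => g • q' j + q j) := by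
    intro g h q q' hq hq'
    refine ⟨by simp [hq.1, hq'.1], fun j => ?_⟩
    have e1 := hq.2 j
    have e2 := congrArg (g • ·) (hq'.2 j)
    simp only [smul_sub, smul_add, smul_smul] at e2
    rw [map_add, map_add, opA_smul σ p _ hσ, dP_smul]
    rw [add_add_add_comm, ← e1, ← e2]
    abel
  choose q hq using exists_htpy σ p hp hσ
  have h1 := hχ (fun g => ((ψ (q g m) : ℤ) : ZMod p)) (by
    intro g k
    rw [hwd _ _ _ (hq (g * k)) (hmul g k _ _ (hq g) (hq k)), map_add, hψ]
    push_cast; ring)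
  have h2 : IsHtpy σ p σ (fun j => if Even j then 0 else pseq σ p j) := by
    refine ⟨by simp, fun j => ?_⟩
    by_cases hj : Even j
    · have : ¬ Even (j + 1) := by simpa [Nat.even_add_one] using hj
      simp only [hj, this, if_true, if_false]
      rw [dP_pseq σ p hp, opA_odd _ _ this]; simp
    · have : Even (j + 1) := by simpa [Nat.even_add_one] using hj
      simp only [hj, this, if_true, if_false]
      rw [opA_odd _ _ hj]; simp
  have h3 := hwd _ _ _ (hq σ) h2
  rw [h1] at h3
  simp only [hm, if_false] at h3
  have h4 := h (pseq σ p (m + 1))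
  rw [dP_pseq σ p hp, inv_opA_even σ p hm' ψ hψ, nsmul_eq_mul] at h4
  have h5 := mul_left_cancel₀ (by exact_mod_cast NeZero.ne p) h4
  rw [h5]
  exact (ZMod.intCast_zmod_eq_zero_iff_dvd _ p).1 h3.symm

/-- A central element of order `p` killed by all homomorphisms to `ZMod p`. -/
lemma exists_sigma (p : ℕ) (hp : p.Prime) [Finite G] (hG : IsPGroup p G)
    (hne : ¬ IsElementaryAbelian p G) : ∃ σ : G, orderOf σ = p ∧ (∀ g : G, g * σ = σ * g) ∧
      ∀ a : G → ZMod p, (∀ g h, a (g * h) = a g + a h) → a σ = 0 := by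
  have := Fact.mk hp
  let K : Subgroup G := ⨅ χ : G →* Multiplicative (ZMod p), χ.ker
  have hK : ∀ x, x ∈ K ↔ ∀ χ : G →* Multiplicative (ZMod p), χ x = 1 := by
    intro x; simp [K, Subgroup.mem_iInf, MonoidHom.mem_ker]
  have hKn : K.Normal := by
    constructor
    intro n hn g
    rw [hK] at hn ⊢
    intro χ
    simp [hn χ]
  have hKb : Nontrivial K := by
    rw [Subgroup.nontrivial_iff_ne_bot]
    intro hb
    apply hne
    have key : ∀ x : G, (∀ χ : G →* Multiplicative (ZMod p), χ x = 1) → x = 1 := by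
      intro x hx
      rw [← hK, hb] at hx
      simpa using hx
    refine ⟨fun a b => ?_, fun g => ?_⟩
    · rw [← mul_inv_eq_one]
      apply key
      intro χ
      rw [map_mul, map_inv, map_mul, map_mul, mul_comm (χ b), mul_inv_cancel]
    · apply key
      intro χ
      rw [map_pow]
      apply Multiplicative.toAdd.injective
      simp
  have hKp : p ∣ Nat.card K := by
    obtain ⟨k, hk, hk'⟩ := ((hG.to_subgroup K).nontrivial_iff_card).1 hKb
    rw [hk']
    exact dvd_pow_self _ hk.ne'
  have hG' : IsPGroup p (ConjAct G) := hG.of_equiv ConjAct.toConjAct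
  obtain ⟨b, hb, hb1⟩ := hG'.exists_fixed_point_of_prime_dvd_card_of_fixed_point (α := K) hKp
    (a := 1) (by intro g; simp)
  let L : Subgroup G := K ⊓ Subgroup.center G
  have hbL : (b : G) ∈ L := by
    refine Subgroup.mem_inf.2 ⟨b.2, Subgroup.mem_center_iff.2 fun g => ?_⟩
    have := congrArg Subtype.val (hb (ConjAct.toConjAct g))
    rw [ConjAct.Subgroup.val_conj_smul, ConjAct.toConjAct_smul] at this
    exact mul_inv_eq_iff_eq_mul.1 this
  have hLn : Nontrivial L := by
    rw [Subgroup.nontrivial_iff_ne_bot]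
    intro h
    rw [h] at hbL
    exact hb1 (Subtype.ext (Subgroup.mem_bot.1 hbL).symm)
  have hLp : p ∣ Nat.card L := by
    obtain ⟨k, hk, hk'⟩ := ((hG.to_subgroup L).nontrivial_iff_card).1 hLn
    rw [hk']
    exact dvd_pow_self _ hk.ne'
  obtain ⟨σ, hσ⟩ := exists_prime_orderOf_dvd_card' p hLp
  refine ⟨σ, by rw [Subgroup.orderOf_coe, hσ], ?_, ?_⟩
  · exact Subgroup.mem_center_iff.1 σ.2.2
  · intro a ha
    have ha1 : a 1 = 0 := by
      have := ha 1 1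
      simpa using this
    have := (hK _).1 σ.2.1
      { toFun := fun g => Multiplicative.ofAdd (a g)
        map_one' := by simp [ha1]
        map_mul' := by simp [ha] }
    exact this
end
end PSq


namespace PSq
section
variable {G : Type} [Group G]

/-- The comparison map from the bar resolution to a suitable exact complex `E`. -/
lemma exists_chainMap {E : Type*} [AddCommGroup E] [DistribMulAction G E]
    (d : E →+ E) (hd : ∀ (g : G) x, d (g • x) = g • d x)
    (S : ℕ → AddSubgroup E) (hS : ∀ j (g : G), ∀ x ∈ S j, g • x ∈ S j)
    (ε : E →+ ℤ) (hε : ∀ (g : G) x, ε (g • x) = ε x)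
    (e0 : E) (he0 : e0 ∈ S 0) (he1 : ε e0 = 1)
    (hd0 : ∀ x ∈ S 0, d x = 0) (hεS : ∀ j, ∀ x ∈ S (j + 1), ε x = 0)
    (hex : ∀ j, ∀ x ∈ S j, d x = 0 → ε x = 0 → ∃ y ∈ S (j + 1), d y = x) :
    ∃ φ : (j : ℕ) → P G j →+ E, (∀ j (g : G) x, φ j (g • x) = g • φ j x) ∧
      (∀ j x, φ j x ∈ S j) ∧ (∀ x, ε (φ 0 x) = eps x) ∧
      ∀ j x, d (φ (j + 1) x) = φ j (dP x) := by
  have base : ∃ φ : P G 0 →+ E, (∀ (g : G) x, φ (g • x) = g • φ x) ∧ (∀ x, φ x ∈ S 0) ∧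
      ∀ x, ε (φ x) = eps x := by
    refine ⟨P.lift (fun v => v 0 • e0), ?_, ?_, ?_⟩
    · intro g x
      apply P.map_smul
      intro v
      simp [P.smul_of, act, mul_smul]
    · intro x
      have : ∀ x, (QuotientAddGroup.mk' (S 0)) (P.lift (fun v : Fin 1 → G => v 0 • e0) x) = 0 := by
        intro x
        have := P.ext' (f := (QuotientAddGroup.mk' (S 0)).comp
          (P.lift (fun v : Fin 1 → G => v 0 • e0))) (g := 0) (by
            intro v
            simpa using hS 0 (v 0) e0 he0)
        exact this x
      simpa using this x
    · intro x
      have := P.ext' (f := ε.comp (P.lift (fun v : Fin 1 → G => v 0 • e0))) (g := eps) (by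
            intro v
            simp [hε, he1, eps])
      exact this x
  let Q (j : ℕ) := {φ : P G j →+ E // (∀ (g : G) x, φ (g • x) = g • φ x) ∧ (∀ x, φ x ∈ S j) ∧
    ∀ x : P G (j + 1), d (φ (dP x)) = 0 ∧ ε (φ (dP x)) = 0}
  have step : ∀ j (φ : Q j), ∃ φ' : Q (j + 1), ∀ x, d (φ'.1 x) = φ.1 (dP x) := by
    intro j φ
    obtain ⟨θ, h1, h2, h3⟩ := exists_lift (G := G) ⊤ id (by simp) (by simp) d (fun h _ x => hd h x)
      (φ.1.comp dP) (by intro h _ x; simp [dP_smul, φ.2.1]) (S (j + 1)) (fun h _ x hx => hS _ h x hx)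
      (fun v => hex j _ (φ.2.2.1 _) (φ.2.2.2 _).1 (φ.2.2.2 _).2)
    refine ⟨⟨θ, fun g x => h1 g (by simp) x, h2, fun x => ⟨?_, hεS _ _ (h2 _)⟩⟩, h3⟩
    rw [h3]
    simp [dP_dP]
  obtain ⟨φ0, a1, a2, a3⟩ := base
  choose nxt hnxt using step
  let Φ : (j : ℕ) → Q j := fun j => Nat.rec (motive := fun j => Q j)
    ⟨φ0, a1, a2, fun x => ⟨hd0 _ (a2 _), by rw [a3, eps_dP]⟩⟩ (fun j φ => nxt j φ) j
  exact ⟨fun j => (Φ j).1, fun j => (Φ j).2.1, fun j => (Φ j).2.2.1, a3, fun j x => hnxt j (Φ j) x⟩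

lemma exists_cocycle {E : Type*} [AddCommGroup E] [DistribMulAction G E]
    (σ : G) (p : ℕ) (hp : 2 ≤ p) (hσp : σ ^ p = 1)
    (d : E →+ E) (hd : ∀ (g : G) x, d (g • x) = g • d x) (hdd : ∀ x, d (d x) = 0)
    (S : ℕ → AddSubgroup E) (hS : ∀ j (g : G), ∀ x ∈ S j, g • x ∈ S j)
    (ε : E →+ ℤ) (hε : ∀ (g : G) x, ε (g • x) = ε x) (hεd : ∀ x, ε (d x) = 0)
    (e0 : E) (he0 : e0 ∈ S 0) (he1 : ε e0 = 1)
    (hd0 : ∀ x ∈ S 0, d x = 0) (hεS : ∀ j, ∀ x ∈ S (j + 1), ε x = 0)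
    (hex : ∀ j, ∀ x ∈ S j, d x = 0 → ε x = 0 → ∃ y ∈ S (j + 1), d y = x)
    (τ : E →+ ℤ) (hτ : ∀ (g : G) x, τ (g • x) = τ x) (hτd : ∀ x, τ (d x) = 0)
    (n : ℕ) (hn : Even n) (top : E) (htop : σ • top = top)
    (hSn : ∀ x ∈ S n, x = τ x • top) (hτS : ∀ j < n, ∀ x ∈ S j, τ x = 0)
    (hfree : ∀ j x, τ x = 0 → opA σ p (j + 1) x = 0 → ∃ y, x = opA σ p j y) :
    ∃ F : P G n →+ ℤ, (∀ (g : G) x, F (g • x) = F x) ∧ (∀ x, F (dP x) = 0) ∧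
      ¬ (p : ℤ) ∣ F (pseq σ p n) := by
  obtain ⟨φ, h1, h2, h3, h4⟩ := exists_chainMap d hd S hS ε hε e0 he0 he1 hd0 hεS hex
  refine ⟨τ.comp (φ n), by simp [h1, hτ], fun x => ?_, ?_⟩
  · simp [← h4, hτd]
  rintro ⟨m, hm⟩
  simp only [AddMonoidHom.comp_apply] at hm
  have hpow : ∀ i : ℕ, σ ^ i • top = top := by
    intro i
    induction i with
    | zero => simp
    | succ i ih => rw [pow_succ, mul_smul, htop, ih]
  have key : ∀ i j, i + j = n → ∃ t t', φ j (pseq σ p j) - d t = opA σ p j t' := by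
    intro i
    induction i with
    | zero =>
      intro j hj
      obtain rfl : j = n := by omega
      refine ⟨0, m • top, ?_⟩
      rw [opA_even _ _ hn, map_zero, sub_zero, hSn _ (h2 _ _), hm]
      simp [smul_comm _ m, hpow, mul_smul, mul_comm (p : ℤ) m]
    | succ i ih =>
      intro j hj
      obtain ⟨t, t', h⟩ := ih (j + 1) (by omega)
      obtain ⟨y, hy⟩ := hfree j (φ j (pseq σ p j) - d t')
        (by rw [map_sub, hτd, hτS j (by omega) _ (h2 _ _), sub_zero]) (by
          have := congrArg d h
          rw [map_sub, hdd, sub_zero, h4, dP_pseq _ _ hσp, map_opA σ p (j + 1) (φ j) (h1 j),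
            map_opA σ p (j + 1) d hd] at this
          rw [map_sub, this, sub_self])
      exact ⟨t', y, hy⟩
  obtain ⟨t, t', h⟩ := key n 0 (by omega)
  have := congrArg ε h
  rw [map_sub, hεd, h3, eps_pseq, opA_even _ _ (by simp), map_sum] at this
  simp only [hε, Finset.sum_const, Finset.card_range, sub_zero, nsmul_eq_mul] at this
  have h5 := Int.eq_one_or_neg_one_of_mul_eq_one this.symm
  omega
end
end PSq


namespace PSq
open Matrix
section
variable (p : ℕ)

/-- Cells of the local complex `0 → ℤ → ℤ[C] → ℤ[C] → 0` (`C` cyclic of order `p`). -/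
abbrev X := Option (Bool × ZMod p)

variable {p}
/-- degree of a cell -/
def lev : X p → ℕ
  | none => 2
  | some (true, _) => 1
  | some (false, _) => 0

/-- sign of a cell -/
def sg (x : X p) : ℤ := (-1) ^ lev x

/-- shift of a cell -/
def sh (c : ZMod p) : X p → X p
  | none => none
  | some (b, a) => some (b, c + a)

lemma sh_zero (x : X p) : sh 0 x = x := by rcases x with _ | ⟨b, a⟩ <;> simp [sh]
lemma sh_add (c c' : ZMod p) (x : X p) : sh (c + c') x = sh c (sh c' x) := by
  rcases x with _ | ⟨b, a⟩ <;> simp [sh, add_assoc]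
@[simp] lemma lev_sh (c : ZMod p) (x : X p) : lev (sh c x) = lev x := by
  rcases x with _ | ⟨_ | _, a⟩ <;> simp [sh, lev]
lemma lev_le (x : X p) : lev x ≤ 2 := by
  rcases x with _ | ⟨_ | _, a⟩ <;> simp [lev]
lemma lev_eq_two (x : X p) (h : lev x = 2) : x = none := by
  rcases x with _ | ⟨_ | _, a⟩ <;> simp_all [lev]

/-- shift as an equivalence -/
def shE (c : ZMod p) : X p ≃ X p where
  toFun := sh c
  invFun := sh (-c)
  left_inv x := by rw [← sh_add]; simp [sh_zero]
  right_inv x := by rw [← sh_add]; simp [sh_zero]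

/-- augmentation -/
def au : X p → ℤ
  | none => 0
  | some (true, _) => 0
  | some (false, _) => 1

lemma au_ne (x : X p) (h : au x ≠ 0) : lev x = 0 := by
  rcases x with _ | ⟨_ | _, a⟩ <;> simp_all [au, lev]
@[simp] lemma au_sh (c : ZMod p) (x : X p) : au (sh c x) = au x := by
  rcases x with _ | ⟨_ | _, a⟩ <;> simp [sh, au]

/-- base cell -/
def bs : X p := some (false, 0)

/-- differential -/
def mD : Matrix (X p) (X p) ℤ
  | some (false, a), some (true, b) => (if b + 1 = a then 1 else 0) - (if b = a then 1 else 0)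
  | some (true, _), none => 1
  | _, _ => 0

/-- contracting homotopy -/
def mH : Matrix (X p) (X p) ℤ
  | some (true, a), some (false, b) => if a.val < b.val then 1 else 0
  | none, some (true, b) => if b + 1 = 0 then 1 else 0
  | _, _ => 0

/-- projection to the base point -/
def mP : Matrix (X p) (X p) ℤ := fun x y => if x = bs then au y else 0

lemma mD_lev (x y : X p) (h : mD x y ≠ 0) : lev x + 1 = lev y := by
  rcases x with _ | ⟨_ | _, a⟩ <;> rcases y with _ | ⟨_ | _, b⟩ <;> simp_all [mD, lev]
lemma mH_lev (x y : X p) (h : mH x y ≠ 0) : lev x = lev y + 1 := by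
  rcases x with _ | ⟨_ | _, a⟩ <;> rcases y with _ | ⟨_ | _, b⟩ <;> simp_all [mH, lev]
lemma mP_lev (x y : X p) (h : mP x y ≠ 0) : lev x = lev y := by
  simp only [mP, ne_eq, ite_eq_right_iff, not_forall] at h
  obtain ⟨rfl, h⟩ := h
  rw [au_ne y h]; rfl
lemma mD_sh (c : ZMod p) (x y : X p) : mD (sh c x) (sh c y) = mD x y := by
  rcases x with _ | ⟨_ | _, a⟩ <;> rcases y with _ | ⟨_ | _, b⟩ <;> simp [mD, sh, add_assoc]
lemma mD_none (y : X p) : mD none y = 0 := by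
  rcases y with _ | ⟨_ | _, b⟩ <;> simp [mD]

variable [NeZero p]

lemma sum_X (f : X p → ℤ) : ∑ x, f x = f none + (∑ a, f (some (false, a)) + ∑ a, f (some (true, a))) := by
  rw [Fintype.sum_option, Fintype.sum_prod_type, Fintype.sum_bool, add_comm (∑ a, f (some (true, a)))]

lemma au_mD (y : X p) : ∑ x, au x * mD x y = 0 := by
  rcases y with _ | ⟨_ | _, b⟩ <;> simp [sum_X, mD, au, -Fintype.sum_option]
lemma au_mP (y : X p) : ∑ x, au x * mP x y = au y := by
  simp [sum_X, mP, bs, au, -Fintype.sum_option]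
lemma mD_mD : (mD : Matrix (X p) (X p) ℤ) * mD = 0 := by
  ext x y
  rcases x with _ | ⟨_ | _, a⟩ <;> rcases y with _ | ⟨_ | _, b⟩ <;>
    simp [Matrix.mul_apply, sum_X, mD, ← eq_sub_iff_add_eq, -Fintype.sum_option]
lemma mP_mD : (mP : Matrix (X p) (X p) ℤ) * mD = 0 := by
  ext x y
  by_cases h : x = bs
  · simp [Matrix.mul_apply, mP, h, au_mD, -Fintype.sum_option]
  · simp [Matrix.mul_apply, mP, h]
lemma mD_mP : (mD : Matrix (X p) (X p) ℤ) * mP = 0 := by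
  ext x y
  rcases x with _ | ⟨_ | _, a⟩ <;>  simp [Matrix.mul_apply, sum_X, mD, mP, bs, -Fintype.sum_option]

lemma val_succ (b : ZMod p) : (b + 1 = 0 ∧ (b + 1).val = 0 ∧ b.val + 1 = p) ∨
    (b + 1 ≠ 0 ∧ (b + 1).val = b.val + 1) := by
  have hp : 0 < p := NeZero.pos p
  have hb := ZMod.val_lt b
  have h : (b + 1).val = (b.val + 1) % p := by
    conv_lhs => rw [← ZMod.natCast_zmod_val b]
    rw [← Nat.cast_succ, ZMod.val_natCast]
  by_cases h0 : b.val + 1 = p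
  · left
    rw [h0, Nat.mod_self] at h
    exact ⟨(ZMod.val_eq_zero _).1 h, h, h0⟩
  · right
    rw [Nat.mod_eq_of_lt (by omega)] at h
    refine ⟨fun h1 => ?_, h⟩
    rw [h1, ZMod.val_zero] at h
    omega

lemma mD_mH : (mD : Matrix (X p) (X p) ℤ) * mH + mH * mD = 1 - mP := by
  ext x y
  rcases x with _ | ⟨_ | _, a⟩ <;> rcases y with _ | ⟨_ | _, b⟩ <;>
    simp [Matrix.mul_apply, sum_X, mD, mH, mP, au, bs, Matrix.one_apply, -Fintype.sum_option,
      mul_sub, ← eq_sub_iff_add_eq]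
  · have h : ∀ x : ZMod p, (if x.val < b.val then
        ((if x = a - 1 then 1 else 0) - if x = a then 1 else 0 : ℤ) else 0) =
        (if x = a - 1 then (if x.val < b.val then 1 else 0) else 0) -
          (if x = a then (if x.val < b.val then 1 else 0) else 0) := by
      intro x; split_ifs <;> simp
    rw [Finset.sum_congr rfl fun x _ => h x, Finset.sum_sub_distrib, Finset.sum_ite_eq' Finset.univ,
      Finset.sum_ite_eq' Finset.univ]
    obtain ⟨c, rfl⟩ : ∃ c, a = c + 1 := ⟨a - 1, by ring⟩
    have hb := ZMod.val_lt b
    have hcb : c + 1 = b ↔ (c + 1).val = b.val := (ZMod.val_injective p).eq_iff.symm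
    simp only [Finset.mem_univ, if_true, add_sub_cancel_right, hcb]
    rcases val_succ c with ⟨h1, h2, h3⟩ | ⟨h1, h2⟩
    · rw [h2]; simp only [h1, if_true]
      split_ifs <;> omega
    · rw [h2]; simp only [h1, if_false]
      split_ifs <;> omega
  · simp only [eq_sub_iff_add_eq, ← add_eq_zero_iff_eq_neg]
    rw [Finset.sum_ite_eq]
    have hb := ZMod.val_lt a
    have hcb : a = b ↔ a.val = b.val := (ZMod.val_injective p).eq_iff.symm
    simp only [Finset.mem_univ, if_true, hcb]
    rcases val_succ b with ⟨h1, h2, h3⟩ | ⟨h1, h2⟩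
    · rw [h2]; simp only [h1, if_true]
      split_ifs <;> omega
    · rw [h2]; simp only [h1, if_false]
      split_ifs <;> omega
end
end PSq


namespace PSq
open Matrix
section
variable {p : ℕ} [NeZero p] {N : ℕ}

/-- Apply a local matrix in the slot `t`. -/
def op (t : Fin N) (M : Matrix (X p) (X p) ℤ) : Module.End ℤ ((Fin N → X p) → ℤ) where
  toFun F s := ∑ x, M (s t) x * F (Function.update s t x)
  map_add' F F' := by
    ext s; simp [mul_add, Finset.sum_add_distrib, -Fintype.sum_option]
  map_smul' c F := by
    ext s; simp [Finset.mul_sum, mul_left_comm, -Fintype.sum_option]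

lemma op_apply (t : Fin N) (M : Matrix (X p) (X p) ℤ) (F : (Fin N → X p) → ℤ) (s : Fin N → X p) :
    op t M F s = ∑ x, M (s t) x * F (Function.update s t x) := rfl

lemma op_mul (t : Fin N) (M M' : Matrix (X p) (X p) ℤ) : op t (M * M') = op t M * op t M' := by
  refine LinearMap.ext fun F => funext fun s => ?_
  simp only [op_apply, Module.End.mul_apply, Matrix.mul_apply, Finset.sum_mul, Finset.mul_sum,
    Function.update_self, Function.update_idem]
  rw [Finset.sum_comm]
  simp only [mul_assoc]

lemma op_add (t : Fin N) (M M' : Matrix (X p) (X p) ℤ) : op t (M + M') = op t M + op t M' := by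
  refine LinearMap.ext fun F => funext fun s => ?_
  simp [op_apply, add_mul, Finset.sum_add_distrib, -Fintype.sum_option]

lemma op_sub (t : Fin N) (M M' : Matrix (X p) (X p) ℤ) : op t (M - M') = op t M - op t M' := by
  refine LinearMap.ext fun F => funext fun s => ?_
  simp [op_apply, sub_mul, Finset.sum_sub_distrib, -Fintype.sum_option]

lemma op_zero (t : Fin N) : op t (0 : Matrix (X p) (X p) ℤ) = 0 := by
  refine LinearMap.ext fun F => funext fun s => ?_
  simp [op_apply]

lemma op_one (t : Fin N) : op t (1 : Matrix (X p) (X p) ℤ) = 1 := by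
  refine LinearMap.ext fun F => funext fun s => ?_
  simp [op_apply, Matrix.one_apply, -Fintype.sum_option]

lemma op_comm {t u : Fin N} (h : t ≠ u) (M M' : Matrix (X p) (X p) ℤ) :
    op t M * op u M' = op u M' * op t M := by
  refine LinearMap.ext fun F => funext fun s => ?_
  simp only [op_apply, Module.End.mul_apply, Finset.mul_sum]
  rw [Finset.sum_comm]
  refine Finset.sum_congr rfl fun x _ => Finset.sum_congr rfl fun y _ => ?_
  rw [Function.update_of_ne h.symm, Function.update_of_ne h, Function.update_comm h, mul_left_comm]

/-- The sign in front of slot `t`. -/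
def js (t : Fin N) (s : Fin N → X p) : ℤ := ∏ u ∈ Finset.Iio t, sg (s u)

lemma sg_sq (x : X p) : sg x * sg x = 1 := by
  rw [sg, ← mul_pow]; simp

lemma js_sq (t : Fin N) (s : Fin N → X p) : js t s * js t s = 1 := by
  rw [js, ← Finset.prod_mul_distrib]
  simp [sg_sq]

lemma js_update_ge {t u : Fin N} (h : ¬ u < t) (s : Fin N → X p) (x : X p) :
    js t (Function.update s u x) = js t s := by
  refine Finset.prod_congr rfl fun v hv => ?_
  rw [Function.update_of_ne]
  rintro rfl
  exact h (Finset.mem_Iio.1 hv)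

lemma js_update_lt {t u : Fin N} (h : u < t) (s : Fin N → X p) (x : X p) :
    js t (Function.update s u x) = js t s * (sg (s u) * sg x) := by
  have hu : u ∈ Finset.Iio t := Finset.mem_Iio.2 h
  rw [js, js, ← Finset.mul_prod_erase _ _ hu, ← Finset.mul_prod_erase _ (fun u => sg (s u)) hu,
    Function.update_self]
  have : ∏ v ∈ (Finset.Iio t).erase u, sg (Function.update s u x v) =
      ∏ v ∈ (Finset.Iio t).erase u, sg (s v) := by
    refine Finset.prod_congr rfl fun v hv => ?_
    rw [Function.update_of_ne (Finset.ne_of_mem_erase hv)]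
  rw [this]
  linear_combination (- sg x * ∏ v ∈ (Finset.Iio t).erase u, sg (s v)) * sg_sq (s u)

/-- multiplication by the sign -/
def J (t : Fin N) : Module.End ℤ ((Fin N → X p) → ℤ) where
  toFun F s := js t s * F s
  map_add' F F' := by ext s; simp [mul_add]
  map_smul' c F := by ext s; simp [mul_left_comm]

lemma J_apply (t : Fin N) (F : (Fin N → X p) → ℤ) (s : Fin N → X p) :
    J t F s = js t s * F s := rfl

lemma J_sq (t : Fin N) : (J t : Module.End ℤ ((Fin N → X p) → ℤ)) * J t = 1 := by
  refine LinearMap.ext fun F => funext fun s => ?_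
  simp [J_apply, ← mul_assoc, js_sq]

lemma J_comm (t u : Fin N) : (J t : Module.End ℤ ((Fin N → X p) → ℤ)) * J u = J u * J t := by
  refine LinearMap.ext fun F => funext fun s => ?_
  simp [J_apply, mul_left_comm]

lemma J_op_ge {t u : Fin N} (h : ¬ u < t) (M : Matrix (X p) (X p) ℤ) :
    J t * op u M = op u M * J t := by
  refine LinearMap.ext fun F => funext fun s => ?_
  simp [J_apply, op_apply, js_update_ge h, Finset.mul_sum, mul_left_comm, -Fintype.sum_option]

lemma J_op_odd {t u : Fin N} (h : u < t) (M : Matrix (X p) (X p) ℤ)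
    (hM : ∀ x y, M x y ≠ 0 → sg x * sg y = -1) :
    J t * op u M = - (op u M * J t) := by
  refine LinearMap.ext fun F => funext fun s => ?_
  simp only [J_apply, op_apply, js_update_lt h, Finset.mul_sum, Module.End.mul_apply,
    LinearMap.neg_apply, Pi.neg_apply, ← Finset.sum_neg_distrib]
  refine Finset.sum_congr rfl fun x _ => ?_
  by_cases h0 : M (s u) x = 0
  · simp [h0]
  · rw [hM _ _ h0]; ring

lemma J_op_even {t u : Fin N} (M : Matrix (X p) (X p) ℤ)
    (hM : ∀ x y, M x y ≠ 0 → sg x * sg y = 1) :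
    J t * op u M = op u M * J t := by
  by_cases h : u < t
  swap
  · exact J_op_ge h M
  refine LinearMap.ext fun F => funext fun s => ?_
  simp only [J_apply, op_apply, js_update_lt h, Finset.mul_sum, Module.End.mul_apply]
  refine Finset.sum_congr rfl fun x _ => ?_
  by_cases h0 : M (s u) x = 0
  · simp [h0]
  · rw [hM _ _ h0]; ring

lemma mD_sg (x y : X p) (h : mD x y ≠ 0) : sg x * sg y = -1 := by
  rw [sg, sg, ← mD_lev x y h, ← pow_add, Odd.neg_one_pow ⟨lev x, by ring⟩]
lemma mH_sg (x y : X p) (h : mH x y ≠ 0) : sg x * sg y = -1 := by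
  rw [sg, sg, mH_lev x y h, ← pow_add, Odd.neg_one_pow ⟨lev y, by ring⟩]
lemma mP_sg (x y : X p) (h : mP x y ≠ 0) : sg x * sg y = 1 := by
  rw [sg, sg, mP_lev x y h, ← pow_add, Even.neg_one_pow ⟨lev y, by ring⟩]

variable (p) in
/-- local differential -/
def dt (t : Fin N) : Module.End ℤ ((Fin N → X p) → ℤ) := J t * op t mD
variable (p) in
/-- local homotopy -/
def ht (t : Fin N) : Module.End ℤ ((Fin N → X p) → ℤ) := J t * op t mH
variable (p) in
/-- local projection -/
def pt (t : Fin N) : Module.End ℤ ((Fin N → X p) → ℤ) := op t mP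

lemma JJ (t : Fin N) (M M' : Matrix (X p) (X p) ℤ) :
    (J t * op t M) * (J t * op t M') = op t (M * M') := by
  calc _ = J t * (op t M * J t) * op t M' := by simp only [mul_assoc]
    _ = (J t * J t) * (op t M * op t M') := by rw [← J_op_ge (lt_irrefl t)]; simp only [mul_assoc]
    _ = _ := by rw [J_sq, one_mul, op_mul]

lemma JJ_anti_lt {t u : Fin N} (h : t < u) (M M' : Matrix (X p) (X p) ℤ)
    (hM : ∀ x y, M x y ≠ 0 → sg x * sg y = -1) :
    (J t * op t M) * (J u * op u M') = - ((J u * op u M') * (J t * op t M)) := by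
  calc _ = J t * (op t M * J u) * op u M' := by simp only [mul_assoc]
    _ = - (J t * (J u * op t M) * op u M') := by rw [J_op_odd h M hM]; simp
    _ = - ((J t * J u) * (op t M * op u M')) := by simp only [mul_assoc]
    _ = - ((J u * J t) * (op u M' * op t M)) := by rw [op_comm h.ne, J_comm]
    _ = - (J u * (J t * op u M') * op t M) := by simp only [mul_assoc]
    _ = - (J u * (op u M' * J t) * op t M) := by rw [J_op_ge h.not_gt]
    _ = _ := by simp only [mul_assoc]

lemma JJ_anti {t u : Fin N} (h : t ≠ u) (M M' : Matrix (X p) (X p) ℤ)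
    (hM : ∀ x y, M x y ≠ 0 → sg x * sg y = -1) (hM' : ∀ x y, M' x y ≠ 0 → sg x * sg y = -1) :
    (J t * op t M) * (J u * op u M') = - ((J u * op u M') * (J t * op t M)) := by
  rcases lt_or_gt_of_ne h with h | h
  · exact JJ_anti_lt h M M' hM
  · rw [JJ_anti_lt h M' M hM', neg_neg]

lemma dt_sq (t : Fin N) : dt p t * dt p t = 0 := by rw [dt, JJ, mD_mD, op_zero]
lemma dt_ht (t : Fin N) : dt p t * ht p t + ht p t * dt p t = 1 - pt p t := by
  rw [dt, ht, JJ, JJ, ← op_add, mD_mH, op_sub, op_one, pt]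
lemma dt_dt {t u : Fin N} (h : t ≠ u) : dt p t * dt p u = - (dt p u * dt p t) :=
  JJ_anti h _ _ mD_sg mD_sg
lemma dt_ht_ne {t u : Fin N} (h : t ≠ u) : dt p t * ht p u = - (ht p u * dt p t) :=
  JJ_anti h _ _ mD_sg mH_sg
lemma pt_dt (t : Fin N) : pt p t * dt p t = 0 := by
  rw [pt, dt, ← mul_assoc, ← J_op_even _ mP_sg, mul_assoc, ← op_mul, mP_mD, op_zero, mul_zero]
lemma dt_pt (t : Fin N) : dt p t * pt p t = 0 := by
  rw [pt, dt, mul_assoc, ← op_mul, mD_mP, op_zero, mul_zero]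
lemma dt_pt_ne {t u : Fin N} (h : t ≠ u) : dt p t * pt p u = pt p u * dt p t := by
  rw [pt, dt, mul_assoc, op_comm h, ← mul_assoc, J_op_even _ mP_sg, mul_assoc]

variable (p N) in
/-- total differential -/
def dd : Module.End ℤ ((Fin N → X p) → ℤ) := ∑ t, dt p t

lemma dd_sq : dd p N * dd p N = 0 := by
  have h : dd p N * dd p N = - (dd p N * dd p N) := by
    simp only [dd, Finset.sum_mul, Finset.mul_sum, ← Finset.sum_neg_distrib]
    rw [Finset.sum_comm]
    refine Finset.sum_congr rfl fun x _ => Finset.sum_congr rfl fun y _ => ?_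
    by_cases h : x = y
    · simp [h, dt_sq]
    · rw [dt_dt (Ne.symm h), neg_neg, dt_dt h]
  refine LinearMap.ext fun F => funext fun s => ?_
  have := congrFun (LinearMap.congr_fun h F) s
  simp only [LinearMap.neg_apply, Pi.neg_apply] at this
  simp only [LinearMap.zero_apply, Pi.zero_apply]
  omega

lemma htpy_main (Q : Module.End ℤ ((Fin N → X p) → ℤ) → Prop) (Q' : Module.End ℤ ((Fin N → X p) → ℤ) → Prop)
    (hQ0 : Q 0) (hQa : ∀ a b, Q a → Q b → Q (a + b)) (hQh : ∀ t, Q (ht p t))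
    (hQp : ∀ t a, Q a → Q (pt p t * a)) (hQ'1 : Q' 1) (hQ'p : ∀ t a, Q' a → Q' (pt p t * a))
    (A : Finset (Fin N)) :
    ∃ H Pj : Module.End ℤ ((Fin N → X p) → ℤ), Q H ∧ Q' Pj ∧
      (∀ u ∉ A, H * dt p u = - (dt p u * H)) ∧
      (∀ t ∈ A, ∀ F s, Pj F s ≠ 0 → s t = bs) ∧
      (∑ t ∈ A, dt p t) * H + H * (∑ t ∈ A, dt p t) = 1 - Pj := by
  induction A using Finset.induction_on with
  | empty => exact ⟨0, 1, hQ0, hQ'1, by simp, by simp, by simp⟩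
  | insert t A htA ih =>
    obtain ⟨H, Pj, h1, h2, h3, h4, h5⟩ := ih
    refine ⟨ht p t + pt p t * H, pt p t * Pj, hQa _ _ (hQh t) (hQp _ _ h1), hQ'p _ _ h2, ?_, ?_, ?_⟩
    · intro u hu
      simp only [Finset.mem_insert, not_or] at hu
      rw [add_mul, mul_add, dt_ht_ne hu.1, mul_assoc, h3 u hu.2, ← mul_assoc, dt_pt_ne hu.1, neg_add,
        neg_neg, mul_neg, mul_assoc]
    · intro u hu F s hs
      rw [Module.End.mul_apply, pt, op_apply] at hs
      by_cases hut : u = t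
      · subst hut
        by_contra h
        apply hs
        simp [mP, h]
      · have hu' : u ∈ A := by simpa [hut] using hu
        by_contra h
        apply hs
        refine Finset.sum_eq_zero fun x _ => ?_
        rw [mul_eq_zero]; right
        by_contra h6
        have := h4 u hu' F _ h6
        rw [Function.update_of_ne hut] at this
        exact h this
    · rw [Finset.sum_insert htA]
      have e1 : (∑ u ∈ A, dt p u) * ht p t + ht p t * (∑ u ∈ A, dt p u) = 0 := by
        rw [Finset.sum_mul, Finset.mul_sum, ← Finset.sum_add_distrib]
        refine Finset.sum_eq_zero fun u hu => ?_
        rw [dt_ht_ne (by rintro rfl; exact htA hu), neg_add_cancel]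
      have e2 : (∑ u ∈ A, dt p u) * pt p t = pt p t * (∑ u ∈ A, dt p u) := by
        rw [Finset.sum_mul, Finset.mul_sum]
        refine Finset.sum_congr rfl fun u hu => ?_
        rw [dt_pt_ne (by rintro rfl; exact htA hu)]
      have e3 : pt p t * H * dt p t = 0 := by
        rw [mul_assoc, h3 t htA, mul_neg, ← mul_assoc, pt_dt, zero_mul, neg_zero]
      have e4 : dt p t * (pt p t * H) = 0 := by rw [← mul_assoc, dt_pt, zero_mul]
      set D := ∑ u ∈ A, dt p u
      calc _ = (dt p t * ht p t + ht p t * dt p t) + (D * ht p t + ht p t * D)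
            + dt p t * (pt p t * H) + pt p t * H * dt p t + (D * pt p t) * H + pt p t * (H * D) := by
              noncomm_ring
        _ = 1 - pt p t + pt p t * (D * H + H * D) := by
              rw [dt_ht, e1, e3, e4, e2]; noncomm_ring
        _ = _ := by rw [h5]; noncomm_ring
end
end PSq


namespace PSq
open Matrix
section
variable {p : ℕ} [NeZero p] {N : ℕ}

/-- degree of a product cell -/
def deg (s : Fin N → X p) : ℕ := ∑ t, lev (s t)

lemma deg_update (s : Fin N → X p) (t : Fin N) (x : X p) :
    deg (Function.update s t x) + lev (s t) = deg s + lev x := by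
  rw [deg, deg, ← Finset.add_sum_erase _ _ (Finset.mem_univ t),
    ← Finset.add_sum_erase _ (fun u => lev (s u)) (Finset.mem_univ t), Function.update_self]
  have : ∑ v ∈ Finset.univ.erase t, lev (Function.update s t x v) =
      ∑ v ∈ Finset.univ.erase t, lev (s v) := by
    refine Finset.sum_congr rfl fun v hv => ?_
    rw [Function.update_of_ne (Finset.ne_of_mem_erase hv)]
  rw [this]
  ring

variable (p N) in
/-- functions supported in degree `j` -/
def SS (j : ℕ) : AddSubgroup ((Fin N → X p) → ℤ) where
  carrier := {F | ∀ s, F s ≠ 0 → deg s = j}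
  add_mem' {F F'} h h' s hs := by
    by_cases h0 : F s = 0
    · exact h' s (by simpa [h0] using hs)
    · exact h s h0
  zero_mem' s hs := by simp at hs
  neg_mem' {F} h s hs := h s (by simpa using hs)

lemma mem_SS {j : ℕ} {F : (Fin N → X p) → ℤ} : F ∈ SS p N j ↔ ∀ s, F s ≠ 0 → deg s = j := Iff.rfl

lemma op_ne {t : Fin N} {M : Matrix (X p) (X p) ℤ} {F : (Fin N → X p) → ℤ} {s : Fin N → X p}
    (h : op t M F s ≠ 0) : ∃ x, M (s t) x ≠ 0 ∧ F (Function.update s t x) ≠ 0 := by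
  rw [op_apply] at h
  obtain ⟨x, _, hx⟩ := Finset.exists_ne_zero_of_sum_ne_zero h
  exact ⟨x, left_ne_zero_of_mul hx, right_ne_zero_of_mul hx⟩

lemma ht_mem {j : ℕ} (t : Fin N) {F : (Fin N → X p) → ℤ} (hF : F ∈ SS p N j) :
    ht p t F ∈ SS p N (j + 1) := by
  intro s hs
  obtain ⟨x, h1, h2⟩ := op_ne (right_ne_zero_of_mul hs)
  have := hF _ h2
  have := deg_update s t x
  have := mH_lev _ _ h1
  omega

lemma pt_mem {j : ℕ} (t : Fin N) {F : (Fin N → X p) → ℤ} (hF : F ∈ SS p N j) :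
    pt p t F ∈ SS p N j := by
  intro s hs
  obtain ⟨x, h1, h2⟩ := op_ne hs
  have := hF _ h2
  have := deg_update s t x
  have := mP_lev _ _ h1
  omega

lemma dd_zero {F : (Fin N → X p) → ℤ} (hF : F ∈ SS p N 0) : dd p N F = 0 := by
  rw [dd, LinearMap.sum_apply]
  refine Finset.sum_eq_zero fun t _ => funext fun s => ?_
  by_contra hs
  obtain ⟨x, h1, h2⟩ := op_ne (right_ne_zero_of_mul hs)
  have := hF _ h2
  have := deg_update s t x
  have := mD_lev _ _ h1
  have : lev (s t) ≤ deg s := Finset.single_le_sum (f := fun t => lev (s t)) (by simp) (Finset.mem_univ t)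
  omega

variable (p N) in
/-- augmentation -/
def ee : ((Fin N → X p) → ℤ) →ₗ[ℤ] ℤ where
  toFun F := ∑ s, (∏ t, au (s t)) * F s
  map_add' F F' := by simp [mul_add, Finset.sum_add_distrib]
  map_smul' c F := by simp [Finset.mul_sum, mul_left_comm]

lemma ee_apply (F : (Fin N → X p) → ℤ) : ee p N F = ∑ s, (∏ t, au (s t)) * F s := rfl

lemma ee_op (t : Fin N) (M : Matrix (X p) (X p) ℤ) (F : (Fin N → X p) → ℤ) :
    ee p N (op t M F) = ∑ s, (∏ u ∈ Finset.univ.erase t, au (s u)) * (∑ x, au x * M x (s t)) * F s := by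
  let e : ((Fin N → X p) × X p) ≃ ((Fin N → X p) × X p) :=
    { toFun := fun q => (Function.update q.1 t q.2, q.1 t)
      invFun := fun q => (Function.update q.1 t q.2, q.1 t)
      left_inv := fun q => by simp
      right_inv := fun q => by simp }
  have h1 : ee p N (op t M F) = ∑ q : (Fin N → X p) × X p,
      (∏ u, au (q.1 u)) * (M (q.1 t) q.2 * F (Function.update q.1 t q.2)) := by
    rw [Fintype.sum_prod_type, ee_apply]
    simp only [op_apply, Finset.mul_sum]
  rw [h1, ← Equiv.sum_comp e, Fintype.sum_prod_type]
  refine Finset.sum_congr rfl fun s _ => ?_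
  rw [Finset.mul_sum, Finset.sum_mul]
  refine Finset.sum_congr rfl fun x _ => ?_
  simp only [e, Equiv.coe_fn_mk, Function.update_self, Function.update_idem, Function.update_eq_self]
  rw [← Finset.mul_prod_erase _ _ (Finset.mem_univ t), Function.update_self]
  have : ∏ v ∈ Finset.univ.erase t, au (Function.update s t x v) =
      ∏ v ∈ Finset.univ.erase t, au (s v) := by
    refine Finset.prod_congr rfl fun v hv => ?_
    rw [Function.update_of_ne (Finset.ne_of_mem_erase hv)]
  rw [this]
  ring

lemma au_prod_ne {s : Fin N → X p} (h : ∏ t, au (s t) ≠ 0) : ∀ t, lev (s t) = 0 := by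
  intro t
  exact au_ne _ (Finset.prod_ne_zero_iff.1 h t (Finset.mem_univ t))

lemma ee_J (t : Fin N) (F : (Fin N → X p) → ℤ) : ee p N (J t F) = ee p N F := by
  rw [ee_apply, ee_apply]
  refine Finset.sum_congr rfl fun s _ => ?_
  by_cases h : ∏ t, au (s t) = 0
  · simp [h]
  · have : js t s = 1 := Finset.prod_eq_one fun u _ => by rw [sg, au_prod_ne h u, pow_zero]
    rw [J_apply, this, one_mul]

lemma ee_dd (F : (Fin N → X p) → ℤ) : ee p N (dd p N F) = 0 := by
  rw [dd, LinearMap.sum_apply, map_sum]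
  refine Finset.sum_eq_zero fun t _ => ?_
  rw [dt, Module.End.mul_apply, ee_J, ee_op]
  simp [au_mD, -Fintype.sum_option]

lemma ee_pt (t : Fin N) (F : (Fin N → X p) → ℤ) : ee p N (pt p t F) = ee p N F := by
  rw [pt, ee_op, ee_apply]
  simp only [au_mP]
  refine Finset.sum_congr rfl fun s _ => ?_
  rw [Finset.prod_erase_mul _ _ (Finset.mem_univ t)]

lemma ee_SS {j : ℕ} {F : (Fin N → X p) → ℤ} (hF : F ∈ SS p N (j + 1)) : ee p N F = 0 := by
  rw [ee_apply]
  refine Finset.sum_eq_zero fun s _ => ?_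
  by_contra h
  have h1 := au_prod_ne (left_ne_zero_of_mul h)
  have h2 := hF s (right_ne_zero_of_mul h)
  simp [deg, h1] at h2

variable (p N) in
/-- base point -/
def bb : (Fin N → X p) → ℤ := Pi.single (fun _ => bs) 1

lemma ee_bb : ee p N (bb p N) = 1 := by
  rw [ee_apply, Finset.sum_eq_single (fun _ => bs)]
  · simp [bb, bs, au]
  · intro s _ hs
    simp [bb, hs]
  · simp

lemma bb_mem : bb p N ∈ SS p N 0 := by
  intro s hs
  have : s = fun _ => bs := by
    by_contra h
    simp [bb, h] at hs
  simp [this, deg, bs, lev]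

lemma dd_exact {j : ℕ} {F : (Fin N → X p) → ℤ} (hF : F ∈ SS p N j) (hd : dd p N F = 0)
    (he : ee p N F = 0) : ∃ F' ∈ SS p N (j + 1), dd p N F' = F := by
  obtain ⟨H, Q, h1, h2, -, h4, h5⟩ := htpy_main (p := p) (N := N)
    (fun H => ∀ j, ∀ F ∈ SS p N j, H F ∈ SS p N (j + 1)) (fun Q => ∀ F, ee p N (Q F) = ee p N F)
    (fun j F _ => (SS p N _).zero_mem) (fun a b ha hb j F hF => (SS p N _).add_mem (ha j F hF) (hb j F hF))
    (fun t j F hF => ht_mem t hF) (fun t a ha j F hF => pt_mem t (ha j F hF)) (fun F => rfl)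
    (fun t a ha F => by rw [Module.End.mul_apply, ee_pt, ha]) Finset.univ
  refine ⟨H F, h1 _ _ hF, ?_⟩
  have h6 : Q F = (Q F (fun _ => bs)) • bb p N := by
    funext s
    by_cases hs : s = fun _ => bs
    · subst hs; simp [bb]
    · have : Q F s = 0 := by
        by_contra h
        exact hs (funext fun t => h4 t (Finset.mem_univ t) F s h)
      simp [bb, hs, this]
  have h7 : Q F (fun _ => bs) = 0 := by
    have := h2 F
    rw [h6, map_smul, ee_bb, he] at this
    simpa using this
  rw [h7, zero_smul] at h6
  have h8 := LinearMap.congr_fun h5 F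
  change dd p N (H F) + H (dd p N F) = F - Q F at h8
  rw [hd, h6, map_zero, add_zero, sub_zero] at h8
  exact h8

/-- the top cell -/
lemma dd_top (F : (Fin N → X p) → ℤ) : dd p N F (fun _ => none) = 0 := by
  rw [dd, LinearMap.sum_apply, Finset.sum_apply]
  refine Finset.sum_eq_zero fun t _ => ?_
  rw [dt, Module.End.mul_apply, J_apply, op_apply]
  simp [mD_none]

lemma deg_top : deg (fun _ : Fin N => (none : X p)) = 2 * N := by
  simp [deg, lev, mul_comm]

lemma eq_top_of_deg {s : Fin N → X p} (h : deg s = 2 * N) : s = fun _ => none := by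
  have h1 : ∑ t : Fin N, lev (s t) = ∑ t : Fin N, 2 := by
    rw [← deg, h]; simp [mul_comm]
  have h2 := (Finset.sum_eq_sum_iff_of_le (fun t _ => lev_le (s t))).1 h1
  exact funext fun t => lev_eq_two _ (h2 t (Finset.mem_univ t))
end
end PSq


namespace PSq
open Matrix
section

/-- Permutation data together with a cocycle. -/
structure Dat (G : Type) [Group G] (p N : ℕ) where
  a : G →* Equiv.Perm (Fin N)
  κ : G → Fin N → ZMod p
  hκ : ∀ g h i, κ (g * h) i = κ g (a h i) + κ h i

variable {G : Type} [Group G] {p : ℕ} [NeZero p] {N : ℕ} (D : Dat G p N)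

/-- action on cells -/
def ga (g : G) (s : Fin N → X p) : Fin N → X p :=
  fun i => sh (D.κ g ((D.a g).symm i)) (s ((D.a g).symm i))

lemma ga_apply (g : G) (s : Fin N → X p) (i : Fin N) : ga D g s (D.a g i) = sh (D.κ g i) (s i) := by
  simp [ga]

lemma κ_one (i : Fin N) : D.κ 1 i = 0 := by
  have := D.hκ 1 1 i
  simpa using this

lemma ga_one (s : Fin N → X p) : ga D 1 s = s := by
  funext i
  have := ga_apply D 1 s i
  simpa [κ_one, sh_zero] using this

lemma ga_mul (g h : G) (s : Fin N → X p) : ga D (g * h) s = ga D g (ga D h s) := by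
  funext i
  obtain ⟨j, rfl⟩ := (D.a (g * h)).surjective i
  rw [ga_apply, map_mul, Equiv.Perm.mul_apply, ga_apply, ga_apply, D.hκ, sh_add]

lemma ga_update (g : G) (s : Fin N → X p) (u : Fin N) (y : X p) :
    ga D g (Function.update s u y) = Function.update (ga D g s) (D.a g u) (sh (D.κ g u) y) := by
  funext i
  obtain ⟨j, rfl⟩ := (D.a g).surjective i
  rw [ga_apply]
  by_cases h : j = u
  · subst h; simp
  · rw [Function.update_of_ne h, Function.update_of_ne ((D.a g).injective.ne h), ga_apply]

lemma sg_sh (c : ZMod p) (x : X p) : sg (sh c x) = sg x := by simp [sg]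

/-- pair sign -/
def w (x y : X p) : ℤ := (-1) ^ (lev x * lev y)
lemma w_comm (x y : X p) : w x y = w y x := by rw [w, w, mul_comm]
lemma w_sq (x y : X p) : w x y * w x y = 1 := by rw [w, ← mul_pow]; simp
lemma w_flip {x y : X p} (h : sg x * sg y = -1) (z : X p) : w y z = w x z * sg z := by
  have hy : sg y = - sg x := by
    linear_combination sg x * h - sg y * sg_sq x
  have e : ∀ x : X p, w x z = sg x ^ lev z := fun x => by rw [w, pow_mul]; rfl
  rw [e, e, hy, neg_pow, mul_comm]; rfl
lemma w_flip' {x y : X p} (h : sg x * sg y = -1) (z : X p) : w z y = w z x * sg z := by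
  rw [w_comm, w_flip h, w_comm]

/-- Koszul sign -/
def sn (g : G) (s : Fin N → X p) : ℤ :=
  ∏ b, ∏ c, if b < c ∧ D.a g c < D.a g b then w (s b) (s c) else 1

lemma sn_one_of (g : G) (h : D.a g = 1) (s : Fin N → X p) : sn D g s = 1 := by
  refine Finset.prod_eq_one fun b _ => Finset.prod_eq_one fun c _ => if_neg ?_
  rw [h]
  rintro ⟨h1, h2⟩
  exact lt_asymm h1 h2

lemma sn_even (g : G) (s : Fin N → X p) (h : ∀ i, Even (lev (s i))) : sn D g s = 1 := by
  refine Finset.prod_eq_one fun b _ => Finset.prod_eq_one fun c _ => ?_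
  rw [w, ((h b).mul_right _).neg_one_pow, ite_self]

lemma w_ga (h : G) (s : Fin N → X p) (b c : Fin N) :
    w (ga D h s (D.a h b)) (ga D h s (D.a h c)) = w (s b) (s c) := by
  simp [w, ga_apply]

lemma sn_mul (g h : G) (s : Fin N → X p) : sn D (g * h) s = sn D g (ga D h s) * sn D h s := by
  have e1 : sn D g (ga D h s) = ∏ b, ∏ c, if D.a h b < D.a h c ∧ D.a (g * h) c < D.a (g * h) b
      then w (s b) (s c) else 1 := by
    rw [sn, ← Equiv.prod_comp (D.a h)]
    refine Finset.prod_congr rfl fun b _ => ?_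
    rw [← Equiv.prod_comp (D.a h)]
    refine Finset.prod_congr rfl fun c _ => ?_
    rw [w_ga]; simp
  rw [e1, sn, sn]
  let Q : Fin N → Fin N → ℤ := fun b c =>
    if b < c ∧ D.a h c < D.a h b ∧ D.a (g * h) b < D.a (g * h) c then w (s b) (s c) else 1
  have hQ : (∏ b, ∏ c, Q c b) * ∏ b, ∏ c, Q b c = 1 := by
    rw [Finset.prod_comm]
    simp only [← Finset.prod_mul_distrib]
    refine Finset.prod_eq_one fun b _ => Finset.prod_eq_one fun c _ => ?_
    simp only [Q]
    split_ifs
    · exact w_sq _ _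
    · rfl
  refine ((mul_one _).symm.trans (congrArg _ hQ.symm)).trans ?_
  simp only [← Finset.prod_mul_distrib]
  refine Finset.prod_congr rfl fun b _ => Finset.prod_congr rfl fun c _ => ?_
  simp only [Q]
  by_cases hbc : b = c
  · subst hbc; simp
  have h1 := (D.a h).injective.ne hbc
  have h2 := (D.a (g * h)).injective.ne hbc
  have hs := w_sq (s b) (s c)
  rw [w_comm (s c) (s b)]
  generalize w (s b) (s c) = W at *
  generalize D.a h b = b1 at *
  generalize D.a h c = c1 at *
  generalize D.a (g * h) b = b2 at *
  generalize D.a (g * h) c = c2 at *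
  rcases lt_or_gt_of_ne hbc with k0 | k0 <;> rcases lt_or_gt_of_ne h1 with k1 | k1 <;>
    rcases lt_or_gt_of_ne h2 with k2 | k2 <;> simp [k0, k1, k2, k0.not_gt, k1.not_gt, k2.not_gt, hs]

lemma sn_one (s : Fin N → X p) : sn D 1 s = 1 := sn_one_of D 1 (map_one _) s

lemma sn_update (g : G) (s : Fin N → X p) (u : Fin N) (y : X p) (h : sg (s u) * sg y = -1) :
    sn D g s * js (D.a g u) (ga D g s) = js u s * sn D g (Function.update s u y) := by
  have e1 : js (D.a g u) (ga D g s) = ∏ v, if D.a g v < D.a g u then sg (s v) else 1 := by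
    rw [js, ← Finset.filter_gt_eq_Iio, Finset.prod_filter, ← Equiv.prod_comp (D.a g)]
    simp [ga_apply, sg_sh]
  have e2 : js u s = ∏ v, if v < u then sg (s v) else 1 := by
    rw [js, ← Finset.filter_gt_eq_Iio, Finset.prod_filter]
  let f1 : Fin N → ℤ := fun c => if u < c ∧ D.a g c < D.a g u then sg (s c) else 1
  let f2 : Fin N → ℤ := fun b => if b < u ∧ D.a g u < D.a g b then sg (s b) else 1
  have e3 : sn D g (Function.update s u y) = sn D g s * ((∏ c, f1 c) * ∏ b, f2 b) := by
    have k1 : ∏ c, f1 c = ∏ b, ∏ c, if b = u then f1 c else 1 := by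
      symm
      rw [Finset.prod_eq_single u]
      · simp
      · intro b _ hb; simp [hb]
      · simp
    have k2 : ∏ b, f2 b = ∏ b, ∏ c, if c = u then f2 b else 1 := by
      simp
    rw [k1, k2, sn, sn]
    simp only [← Finset.prod_mul_distrib]
    refine Finset.prod_congr rfl fun b _ => Finset.prod_congr rfl fun c _ => ?_
    simp only [f1, f2]
    by_cases hb : b = u
    · subst hb
      by_cases hc : c = b
      · subst hc; simp
      · rw [Function.update_self, Function.update_of_ne hc, w_flip h]
        simp only [hc, if_true, if_false]
        split_ifs <;> simp
    · by_cases hc : c = u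
      · subst hc
        rw [Function.update_self, Function.update_of_ne hb, w_flip' h]
        simp only [hb, if_true, if_false]
        split_ifs <;> simp
      · rw [Function.update_of_ne hb, Function.update_of_ne hc]
        simp [hb, hc]
  rw [e3, e1, e2, mul_left_comm]
  congr 1
  simp only [← Finset.prod_mul_distrib]
  refine Finset.prod_congr rfl fun v _ => ?_
  simp only [f1, f2]
  by_cases hv : v = u
  · subst hv; simp
  have h1 := (D.a g).injective.ne hv
  have hs := sg_sq (s v)
  generalize D.a g v = b1 at *
  generalize D.a g u = c1 at *
  rcases lt_or_gt_of_ne hv with k0 | k0 <;> rcases lt_or_gt_of_ne h1 with k1 | k1 <;>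
    simp [k0, k1, k0.not_gt, k1.not_gt, hs]

/-- The module of chains with its twisted action. -/
def Dat.E (_D : Dat G p N) : Type := (Fin N → X p) → ℤ

instance : AddCommGroup D.E := inferInstanceAs (AddCommGroup ((Fin N → X p) → ℤ))

/-- the action, on underlying functions -/
def gact (g : G) (F : (Fin N → X p) → ℤ) : (Fin N → X p) → ℤ :=
  fun s => sn D g⁻¹ s * F (ga D g⁻¹ s)

instance : DistribMulAction G D.E where
  smul g F := gact D g F
  one_smul F := funext fun s => by
    change sn D 1⁻¹ s * F (ga D 1⁻¹ s) = F s
    rw [inv_one, sn_one, one_mul, ga_one]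
  mul_smul g h F := funext fun s => by
    change sn D (g * h)⁻¹ s * F (ga D (g * h)⁻¹ s) =
      sn D g⁻¹ s * (sn D h⁻¹ (ga D g⁻¹ s) * F (ga D h⁻¹ (ga D g⁻¹ s)))
    rw [_root_.mul_inv_rev, sn_mul, ga_mul]
    ring
  smul_zero g := funext fun s => mul_zero _
  smul_add g F F' := funext fun s => mul_add _ _ _

lemma smul_apply (g : G) (F : D.E) (s : Fin N → X p) :
    (g • F) s = sn D g⁻¹ s * F (ga D g⁻¹ s) := rfl

lemma dt_gact (g : G) (u : Fin N) (F : (Fin N → X p) → ℤ) :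
    dt p u (gact D g F) = gact D g (dt p (D.a g⁻¹ u) F) := by
  funext s
  rw [gact, dt, dt, Module.End.mul_apply, Module.End.mul_apply, J_apply, J_apply, op_apply, op_apply]
  conv_rhs => rw [← Equiv.sum_comp (shE (D.κ g⁻¹ u))]
  rw [Finset.mul_sum, ← mul_assoc, Finset.mul_sum]
  refine Finset.sum_congr rfl fun y _ => ?_
  change _ = _ * (mD _ (sh _ y) * F (Function.update _ _ (sh _ y)))
  rw [ga_apply, mD_sh, ← ga_update]
  by_cases h : mD (s u) y = 0
  · simp [h]
  · rw [sn_update D g⁻¹ s u y (mD_sg _ _ h), gact]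
    ring

lemma dd_gact (g : G) (F : (Fin N → X p) → ℤ) : dd p N (gact D g F) = gact D g (dd p N F) := by
  have e : gact D g (dd p N F) = ∑ u, gact D g (dt p u F) := by
    funext s
    rw [gact, dd, LinearMap.sum_apply, Finset.sum_apply, Finset.sum_apply, Finset.mul_sum]
    rfl
  rw [e, dd, LinearMap.sum_apply]
  conv_rhs => rw [← Equiv.sum_comp (D.a g⁻¹)]
  exact Finset.sum_congr rfl fun u _ => dt_gact D g u F

lemma deg_ga (g : G) (s : Fin N → X p) : deg (ga D g s) = deg s := by
  rw [deg, deg, ← Equiv.sum_comp (D.a g)]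
  simp [ga_apply]

lemma gact_mem {j : ℕ} (g : G) {F : (Fin N → X p) → ℤ} (hF : F ∈ SS p N j) :
    gact D g F ∈ SS p N j := by
  intro s hs
  rw [← deg_ga D g⁻¹ s]
  exact hF _ (right_ne_zero_of_mul hs)

lemma ee_gact (g : G) (F : (Fin N → X p) → ℤ) : ee p N (gact D g F) = ee p N F := by
  let e : (Fin N → X p) ≃ (Fin N → X p) :=
    { toFun := ga D g⁻¹
      invFun := ga D g
      left_inv := fun s => by rw [← ga_mul]; simp [ga_one]
      right_inv := fun s => by rw [← ga_mul]; simp [ga_one] }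
  rw [ee_apply, ee_apply]
  conv_rhs => rw [← Equiv.sum_comp e]
  refine Finset.sum_congr rfl fun s _ => ?_
  change _ = (∏ t, au (ga D g⁻¹ s t)) * F (ga D g⁻¹ s)
  have h1 : ∏ t, au (ga D g⁻¹ s t) = ∏ t, au (s t) := by
    rw [← Equiv.prod_comp (D.a g⁻¹)]
    simp only [ga_apply, au_sh]
  rw [h1, gact]
  by_cases h : ∏ t, au (s t) = 0
  · simp [h]
  · rw [sn_even D g⁻¹ s fun i => by rw [au_prod_ne h i]; exact Even.zero, one_mul]

lemma ga_top (g : G) : ga D g (fun _ => none) = fun _ => none := by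
  funext i; rfl

lemma gact_top (g : G) (F : (Fin N → X p) → ℤ) : gact D g F (fun _ => none) = F (fun _ => none) := by
  rw [gact, ga_top, sn_even D _ _ fun i => by simp [lev], one_mul]
end
end PSq


namespace PSq
section
variable {G : Type} [Group G] {p : ℕ} [NeZero p] {N : ℕ} (D : Dat G p N)

/-- A slot in which the cell is not the top cell. -/
noncomputable def slot (A : Set (Fin N)) : Option (Fin N) :=
  open Classical in if h : A.Nonempty then some h.some else none

lemma slot_spec {A : Set (Fin N)} (h : A.Nonempty) : ∃ t ∈ A, slot A = some t :=
  ⟨h.some, h.some_mem, by simp [slot, h]⟩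

/-- selector on one cell -/
def sel1 : X p → ℤ
  | none => 0
  | some (_, c) => if c = 0 then 1 else 0

/-- selector of a representative for the cyclic group -/
noncomputable def sel (s : Fin N → X p) : ℤ :=
  match slot {t | s t ≠ none} with
  | none => 0
  | some t => sel1 (s t)

lemma sum_range_zmod (c : ZMod p) : ∑ i ∈ Finset.range p, (if (i : ZMod p) = c then (1 : ℤ) else 0) = 1 := by
  rw [Finset.sum_eq_single c.val]
  · simp
  · intro i hi hne
    rw [if_neg]
    rintro rfl
    rw [ZMod.val_natCast, Nat.mod_eq_of_lt (Finset.mem_range.1 hi)] at hne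
    exact hne rfl
  · intro h
    exact absurd (Finset.mem_range.2 (ZMod.val_lt c)) h

/-- uniform shift of all slots -/
def shA (c : ZMod p) (s : Fin N → X p) : Fin N → X p := fun t => sh c (s t)

lemma sel_shA {s : Fin N → X p} (h : s ≠ fun _ => none) : ∃ a : ZMod p, ∀ c : ZMod p,
    sel (shA c s) = if c = a then 1 else 0 := by
  have hne : ({t | s t ≠ none} : Set (Fin N)).Nonempty := by
    by_contra h0
    apply h
    funext t
    by_contra ht
    exact h0 ⟨t, ht⟩
  obtain ⟨t, ht, hs⟩ := slot_spec hne
  obtain ⟨⟨b, a⟩, ha⟩ := Option.ne_none_iff_exists'.1 ht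
  refine ⟨-a, fun c => ?_⟩
  have e : {t | shA c s t ≠ none} = {t | s t ≠ none} := by
    ext t
    simp only [shA, Set.mem_setOf_eq]
    rcases s t with _ | ⟨b, a⟩ <;> simp [sh]
  rw [sel, e, hs]
  simp only [shA, ha, sh, sel1, add_eq_zero_iff_eq_neg]

lemma sum_sel_pos {s : Fin N → X p} (h : s ≠ fun _ => none) :
    ∑ i ∈ Finset.range p, sel (shA (i : ZMod p) s) = 1 := by
  obtain ⟨a, ha⟩ := sel_shA h
  simp only [ha, sum_range_zmod]

lemma sum_sel_neg {s : Fin N → X p} (h : s ≠ fun _ => none) :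
    ∑ i ∈ Finset.range p, sel (shA (-(i : ZMod p)) s) = 1 := by
  obtain ⟨a, ha⟩ := sel_shA h
  simp only [ha, neg_eq_iff_eq_neg, sum_range_zmod]

variable {σ : G}

lemma a_pow (h : D.a σ = 1) (i : ℕ) : D.a (σ ^ i) = 1 := by rw [map_pow, h, one_pow]
lemma κ_pow (h : D.a σ = 1) (hκ : ∀ t, D.κ σ t = 1) (i : ℕ) (t : Fin N) : D.κ (σ ^ i) t = i := by
  induction i with
  | zero => simpa using κ_one D t
  | succ i ih => rw [pow_succ, D.hκ, h, hκ, Equiv.Perm.one_apply, ih]; push_cast; ring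
lemma κ_pow_inv (h : D.a σ = 1) (hκ : ∀ t, D.κ σ t = 1) (i : ℕ) (t : Fin N) :
    D.κ (σ ^ i)⁻¹ t = -(i : ZMod p) := by
  have := D.hκ (σ ^ i)⁻¹ (σ ^ i) t
  rw [inv_mul_cancel, κ_one, a_pow D h, κ_pow D h hκ, Equiv.Perm.one_apply] at this
  exact eq_neg_of_add_eq_zero_left this.symm

lemma pow_smul_apply (h : D.a σ = 1) (hκ : ∀ t, D.κ σ t = 1) (i : ℕ) (F : D.E) (s : Fin N → X p) :
    (σ ^ i • F) s = F (shA (-(i : ZMod p)) s) := by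
  have h1 : D.a (σ ^ i)⁻¹ = 1 := by rw [map_inv, a_pow D h, inv_one]
  rw [smul_apply, sn_one_of D _ h1, one_mul]
  congr 1
  funext t
  simp only [ga, h1, κ_pow_inv D h hκ, shA]; rfl

lemma pow_inv_smul_apply (h : D.a σ = 1) (hκ : ∀ t, D.κ σ t = 1) (i : ℕ) (F : D.E) (s : Fin N → X p) :
    ((σ ^ i)⁻¹ • F) s = F (shA (i : ZMod p) s) := by
  rw [smul_apply, inv_inv, sn_one_of D _ (a_pow D h i), one_mul]
  congr 1
  funext t
  simp only [ga, a_pow D h, κ_pow D h hκ, shA]; rfl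

/-- multiplication by the selector -/
noncomputable def selM : D.E →+ D.E where
  toFun F := fun s => sel s * F s
  map_zero' := funext fun s => mul_zero _
  map_add' F F' := funext fun s => mul_add _ _ _

lemma selM_apply (F : D.E) (s : Fin N → X p) : selM D F s = sel s * F s := rfl

lemma E_sum_apply {ι : Type*} (A : Finset ι) (f : ι → D.E) (s : Fin N → X p) :
    (∑ i ∈ A, f i) s = ∑ i ∈ A, f i s :=
  Finset.sum_apply (M := fun _ : Fin N → X p => ℤ) s A f

lemma shA_top (c : ZMod p) : shA c (fun _ : Fin N => none) = fun _ => none := rfl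

lemma free_inv (h : D.a σ = 1) (hκ : ∀ t, D.κ σ t = 1) (F : D.E) (h0 : F (fun _ => none) = 0)
    (hF : σ • F = F) : F = ∑ i ∈ Finset.range p, σ ^ i • selM D F := by
  have hpow : ∀ i : ℕ, σ ^ i • F = F := by
    intro i
    induction i with
    | zero => simp
    | succ i ih => rw [pow_succ, mul_smul, hF, ih]
  funext s
  rw [E_sum_apply]
  have : ∀ i ∈ Finset.range p, (σ ^ i • selM D F) s = sel (shA (-(i : ZMod p)) s) * F s := by
    intro i _
    rw [pow_smul_apply D h hκ, selM_apply, ← pow_smul_apply D h hκ i F s, hpow]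
  rw [Finset.sum_congr rfl this, ← Finset.sum_mul]
  by_cases hs : s = fun _ => none
  · rw [hs, h0, mul_zero]
  · rw [sum_sel_neg hs, one_mul]

lemma free_norm (h : D.a σ = 1) (hκ : ∀ t, D.κ σ t = 1) (F : D.E) (h0 : F (fun _ => none) = 0)
    (hF : ∑ i ∈ Finset.range p, σ ^ i • F = 0) : ∃ F', F = σ • F' - F' := by
  have e1 : F = ∑ i ∈ Finset.range p, (σ ^ i)⁻¹ • selM D (σ ^ i • F) := by
    funext s
    rw [E_sum_apply]
    have : ∀ i ∈ Finset.range p, ((σ ^ i)⁻¹ • selM D (σ ^ i • F)) s = sel (shA (i : ZMod p) s) * F s := by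
      intro i _
      rw [pow_inv_smul_apply D h hκ, selM_apply, ← pow_inv_smul_apply D h hκ i (σ ^ i • F) s, inv_smul_smul]
    rw [Finset.sum_congr rfl this, ← Finset.sum_mul]
    by_cases hs : s = fun _ => none
    · rw [hs, h0, mul_zero]
    · rw [sum_sel_pos hs, one_mul]
  have e2 : ∑ i ∈ Finset.range p, selM D (σ ^ i • F) = 0 := by
    rw [← map_sum, hF, map_zero]
  let R : AddSubgroup D.E := (DistribSMul.toAddMonoidHom D.E σ - AddMonoidHom.id D.E).range
  have hR : ∀ (i : ℕ) (z : D.E), σ ^ i • z - z ∈ R := by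
    intro i z
    induction i with
    | zero => simp
    | succ i ih =>
      have : σ ^ (i + 1) • z - z = (σ • (σ ^ i • z) - σ ^ i • z) + (σ ^ i • z - z) := by
        rw [pow_succ', mul_smul]; abel
      rw [this]
      exact R.add_mem ⟨σ ^ i • z, rfl⟩ ih
  have hmem : F ∈ R := by
    have : F = ∑ i ∈ Finset.range p, ((σ ^ i)⁻¹ • selM D (σ ^ i • F) - selM D (σ ^ i • F)) := by
      rw [Finset.sum_sub_distrib, e2, sub_zero]; exact e1
    rw [this]
    refine R.sum_mem fun i _ => ?_
    have h3 := R.neg_mem (hR i ((σ ^ i)⁻¹ • selM D (σ ^ i • F)))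
    rwa [smul_inv_smul, neg_sub] at h3
  obtain ⟨F', hF'⟩ := hmem
  exact ⟨F', hF'.symm⟩

/-- The cocycle coming from permutation data. -/
lemma exists_cocycle_of_dat (hp : 2 ≤ p) (hσp : σ ^ p = 1) (h : D.a σ = 1) (hκ : ∀ t, D.κ σ t = 1) :
    ∃ F : P G (2 * N) →+ ℤ, (∀ (g : G) x, F (g • x) = F x) ∧ (∀ x, F (dP x) = 0) ∧
      ¬ (p : ℤ) ∣ F (pseq σ p (2 * N)) := by
  let d : D.E →+ D.E := (dd p N).toAddMonoidHom
  let ε : D.E →+ ℤ := (ee p N).toAddMonoidHom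
  let τ : D.E →+ ℤ := Pi.evalAddMonoidHom (fun _ : Fin N → X p => ℤ) (fun _ => none)
  let S : ℕ → AddSubgroup D.E := SS p N
  let tp : D.E := (Pi.single (fun _ => none) 1 : (Fin N → X p) → ℤ)
  refine exists_cocycle (E := D.E) σ p hp hσp d (fun g F => dd_gact D g F)
    (fun F => LinearMap.congr_fun dd_sq F) S (fun j g x hx => gact_mem D g hx) ε
    (fun g F => ee_gact D g F) (fun F => ee_dd F) (bb p N) bb_mem ee_bb (fun x hx => dd_zero hx)
    (fun j x hx => ee_SS hx) (fun j x hx h1 h2 => dd_exact hx h1 h2) τ (fun g F => gact_top D g F)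
    (fun F => dd_top F) (2 * N) (by simp) tp ?_ ?_ ?_ ?_
  · funext s
    have := pow_smul_apply D h hκ 1 tp s
    rw [pow_one] at this
    rw [this]
    by_cases hs : s = fun _ => none
    · rw [hs]; rfl
    · have hs' : shA (-((1 : ℕ) : ZMod p)) s ≠ fun _ => none := by
        intro h1
        apply hs
        funext t
        have := congrFun h1 t
        simp only [shA] at this
        rcases hst : s t with _ | ⟨b, a⟩
        · rfl
        · rw [hst] at this; simp [sh] at this
      simp only [tp]
      rw [Pi.single_eq_of_ne hs', Pi.single_eq_of_ne hs]
  · intro F hF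
    have : (F : (Fin N → X p) → ℤ) = F (fun _ => none) • (Pi.single (fun _ => none) 1 : (Fin N → X p) → ℤ) := by
      funext s
      by_cases hs : s = fun _ => none
      · rw [hs]; simp
      · have : F s = 0 := by
          by_contra h1
          exact hs (eq_top_of_deg (hF s h1))
        simp [hs, this]
    exact this
  · intro j hj F hF
    by_contra h1
    have := hF _ h1
    rw [deg_top] at this
    omega
  · intro j F h0 h1
    by_cases hj : Even j
    · rw [opA_odd _ _ (by simpa [Nat.even_add_one] using hj), sub_eq_zero] at h1
      refine ⟨selM D F, ?_⟩
      rw [opA_even _ _ hj]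
      exact free_inv D h hκ F h0 h1
    · rw [opA_even _ _ (by simpa [Nat.even_add_one] using hj)] at h1
      obtain ⟨F', hF'⟩ := free_norm D h hκ F h0 h1
      exact ⟨F', by rw [opA_odd _ _ hj]; exact hF'⟩
end
end PSq


namespace PSq
section
variable {G : Type} [Group G]

lemma exists_dat [Finite G] {p : ℕ} (hp : p.Prime) {σ : G} (ho : orderOf σ = p)
    (hσ : ∀ g : G, g * σ = σ * g) (k : ℕ) :
    ∃ N, k ≤ N ∧ ∃ D : Dat G p N, D.a σ = 1 ∧ ∀ t, D.κ σ t = 1 := by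
  classical
  have : NeZero p := ⟨hp.ne_zero⟩
  let Z : Subgroup G := Subgroup.zpowers σ
  have hfin : Fintype (G ⧸ Z) := Fintype.ofFinite _
  have hex : ∀ (g : G) (t : G ⧸ Z), ∃ c : ZMod p, σ ^ c.val = (g • t).out⁻¹ * g * t.out := by
    intro g t
    have hmem : (g • t).out⁻¹ * (g * t.out) ∈ Z := by
      rw [← QuotientGroup.eq, QuotientGroup.out_eq']
      conv_lhs => rw [← QuotientGroup.out_eq' t]
      rfl
    obtain ⟨n, hn⟩ := (mem_zpowers_iff_mem_range_orderOf).1 hmem |> Finset.mem_image.1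
    refine ⟨n, ?_⟩
    rw [ZMod.val_natCast, ← ho, pow_mod_orderOf, hn.2, mul_assoc]
  choose c hc using hex
  have hinj : ∀ x y : ZMod p, σ ^ x.val = σ ^ y.val → x = y := by
    intro x y hxy
    apply ZMod.val_injective p
    exact pow_injOn_Iio_orderOf (by rw [ho]; exact ZMod.val_lt x) (by rw [ho]; exact ZMod.val_lt y) hxy
  have hcc : ∀ g h t, c (g * h) t = c g (h • t) + c h t := by
    intro g h t
    apply hinj
    have hmod : ∀ n : ℕ, σ ^ (n % p) = σ ^ n := fun n => by
      conv_lhs => rw [← ho, pow_mod_orderOf]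
    rw [ZMod.val_add, hmod, pow_add, hc, hc, hc, mul_smul]
    group
  have hst : ∀ t : G ⧸ Z, σ • t = t := by
    intro t
    induction t using QuotientGroup.induction_on with
    | H x =>
      change ((σ * x : G) : G ⧸ Z) = x
      rw [← hσ, eq_comm, QuotientGroup.eq]
      simp [Z]
  have hσc : ∀ t, c σ t = 1 := by
    intro t
    apply hinj
    have : Fact (1 < p) := ⟨hp.one_lt⟩
    rw [hc, hst, ZMod.val_one, pow_one, mul_assoc, ← hσ, inv_mul_cancel_left]
  let e : (G ⧸ Z) × Fin k ≃ Fin (Fintype.card ((G ⧸ Z) × Fin k)) := Fintype.equivFin _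
  let a0 : G →* Equiv.Perm ((G ⧸ Z) × Fin k) :=
    { toFun := fun g => Equiv.prodCongr (MulAction.toPerm g) (Equiv.refl _)
      map_one' := by ext ⟨x, y⟩ <;> simp
      map_mul' := fun g h => by ext ⟨x, y⟩ <;> simp [mul_smul] }
  refine ⟨Fintype.card ((G ⧸ Z) × Fin k), ?_, ⟨e.permCongrHom.toMonoidHom.comp a0,
    fun g i => c g (e.symm i).1, ?_⟩, ?_, ?_⟩
  · rw [Fintype.card_prod, Fintype.card_fin]
    exact Nat.le_mul_of_pos_left _ Fintype.card_pos
  · intro g h i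
    simp [hcc, a0]
  · have ha0 : a0 σ = 1 := by ext ⟨x, y⟩ <;> simp [a0, hst]
    rw [MonoidHom.comp_apply, ha0, map_one]
  · intro t
    exact hσc _

lemma main_exists (p : ℕ) (hp : p.Prime) [Finite G] (hG : IsPGroup p G)
    (hne : ¬ IsElementaryAbelian p G) (k : ℕ) :
    ∃ i, k ≤ i ∧ ∃ χ : groupCohomology (Rep.trivial ℤ G ℤ) i, addOrderOf χ = p ^ 2 := by
  have : NeZero p := ⟨hp.ne_zero⟩
  have : Fact p.Prime := ⟨hp⟩
  obtain ⟨σ, ho, hσ, hχ⟩ := exists_sigma p hp hG hne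
  obtain ⟨N, hN, D, h1, h2⟩ := exists_dat hp ho hσ (k + 1)
  have hσp : σ ^ p = 1 := by rw [← ho, pow_orderOf_eq_one]
  have hcoc := exists_cocycle_of_dat D hp.two_le hσp h1 h2
  obtain ⟨m, hm⟩ : ∃ m, 2 * N = m + 1 := ⟨2 * N - 1, by omega⟩
  rw [hm] at hcoc
  obtain ⟨F, hF, hd, hdiv⟩ := hcoc
  have hmo : ¬ Even m := by
    rintro ⟨r, hr⟩
    omega
  obtain ⟨χ, hR⟩ := exists_class F hF hd
  have hpχ : p • χ ≠ 0 := by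
    intro h0
    obtain ⟨ψ, hψ, h⟩ := (hR p).1 h0
    exact hdiv (ladder σ p hσp hσ hχ hmo F ψ hψ h)
  have hcχ : Nat.card G • χ = 0 := (hR _).2 (card_smul_coboundary F hF hd)
  obtain ⟨s, hs⟩ := IsPGroup.iff_card.1 hG
  rw [hs, ← addOrderOf_dvd_iff_nsmul_eq_zero] at hcχ
  obtain ⟨a, -, ha⟩ := (Nat.dvd_prime_pow hp).1 hcχ
  have ha2 : 2 ≤ a := by
    by_contra hlt
    apply hpχ
    rw [← addOrderOf_dvd_iff_nsmul_eq_zero, ha]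
    exact (pow_dvd_pow p (by omega : a ≤ 1)).trans (by simp)
  refine ⟨m + 1, by omega, p ^ (a - 2) • χ, ?_⟩
  rw [addOrderOf_nsmul_of_dvd (pow_ne_zero _ hp.ne_zero) (by rw [ha]; exact pow_dvd_pow p (by omega)),
    ha, Nat.pow_div (by omega) hp.pos]
  congr 1
  omega
end
end PSq

theorem not_elementaryAbelian_iff_exists_order_p_sq
    (p : ℕ) (hp : p.Prime) (G : Type) [Group G] [Finite G] (hG : IsPGroup p G) :
    (¬ IsElementaryAbelian p G ↔
      ∃ i, ∃ χ : groupCohomology (Rep.trivial ℤ G ℤ) i, addOrderOf χ = p ^ 2) ∧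
    ((∃ i, ∃ χ : groupCohomology (Rep.trivial ℤ G ℤ) i, addOrderOf χ = p ^ 2) ↔
      {i : ℕ | ∃ χ : groupCohomology (Rep.trivial ℤ G ℤ) i,
        addOrderOf χ = p ^ 2}.Infinite) := by
  have h1 : ¬ IsElementaryAbelian p G ↔
      ∃ i, ∃ χ : groupCohomology (Rep.trivial ℤ G ℤ) i, addOrderOf χ = p ^ 2 := by
    constructor
    · intro hne
      obtain ⟨i, -, χ, hχ⟩ := PSq.main_exists p hp hG hne 0
      exact ⟨i, χ, hχ⟩
    · rintro ⟨i, χ, hχ⟩ he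
      exact PSq.elem_main p hp he i χ hχ
  refine ⟨h1, fun h => ?_, fun h => h.nonempty⟩
  refine Set.infinite_of_forall_exists_gt fun k => ?_
  obtain ⟨i, hi, χ, hχ⟩ := PSq.main_exists p hp hG (h1.2 h) (k + 1)
  exact ⟨i, ⟨χ, hχ⟩, hi⟩
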